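/- arXiv:1601.03008 — 6 statements merged into one kernel-verified Lean document; each statement's English description precedes it below -/
import Mathlib

section
/- Let V be a G-graded simple left R-module. Then the centralizer C(V) = Hom_R(V,V) coincides with the graded centralizer C^gr(V); that is, every R-module endomorphism of V is a finite sum of homogeneous R-module endomorphisms. -/
/-! Common definitions: gradings on algebras and modules, graded simplicity,
homogeneous endomorphisms, graded subfields, and loop modules. -/

noncomputable section

namespace GradedPaper

variable {F : Type*} [Field F]

/-- `ℳ` is a direct sum decomposition of the `F`-vector space `V`:
every vector is a finite sum of homogeneous components, and such
decompositions are unique (independence). -/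
def IsVSDecomp {V ι : Type*} [AddCommGroup V] [Module F V]
    (ℳ : ι → Submodule F V) : Prop :=
  (∀ v : V, ∃ (t : Finset ι) (c : ι → V), (∀ i ∈ t, c i ∈ ℳ i) ∧ v = ∑ i ∈ t, c i) ∧
  (∀ (t : Finset ι) (c : ι → V), (∀ i ∈ t, c i ∈ ℳ i) → ∑ i ∈ t, c i = 0 →
    ∀ i ∈ t, c i = 0)

/-- A `G`-grading on a unital associative `F`-algebra `R`:
`R = ⊕_{g ∈ G} R_g` with `1 ∈ R_0` and `R_g · R_h ⊆ R_{g+h}`.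
(The abelian grading group is written additively.) -/
structure AlgebraGrading (F : Type*) [Field F] (G : Type*) [AddCommGroup G]
    (R : Type*) [Ring R] [Algebra F R] where
  comp : G → Submodule F R
  decomp : IsVSDecomp comp
  one_mem : (1 : R) ∈ comp 0
  mul_mem : ∀ {g h : G} {r s : R}, r ∈ comp g → s ∈ comp h → r * s ∈ comp (g + h)

variable {G : Type*} [AddCommGroup G] {R : Type*} [Ring R] [Algebra F R]

/-- A grading of a left `R`-module `V` by the group `κ`, compatible with the
`G`-grading `𝒜` of `R` along the homomorphism `p : G →+ κ`
(so `R_g · V_k ⊆ V_{p g + k}`).  For `p = id` this is a `G`-graded module;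
for `p : G →+ G ⧸ H` the natural projection, this is a `G/H`-graded module
(for the induced `G/H`-grading of `R`). -/
structure ModuleGrading (𝒜 : AlgebraGrading F G R) {κ : Type*} [AddCommGroup κ]
    (p : G →+ κ) (V : Type*) [AddCommGroup V] [Module F V] [Module R V]
    [IsScalarTower F R V] where
  comp : κ → Submodule F V
  decomp : IsVSDecomp comp
  smul_mem : ∀ {g : G} {k : κ} {r : R} {v : V},
    r ∈ 𝒜.comp g → v ∈ comp k → r • v ∈ comp (p g + k)

/-- `W` is a graded submodule: every element of `W` is a finite sum of
homogeneous elements of `W`. -/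
def IsGradedSubmodule {κ V : Type*} [AddCommGroup V] [Module F V] [Module R V]
    (ℳ : κ → Submodule F V) (W : Submodule R V) : Prop :=
  ∀ w ∈ W, ∃ (t : Finset κ) (c : κ → V),
    (∀ i ∈ t, c i ∈ ℳ i ∧ c i ∈ W) ∧ w = ∑ i ∈ t, c i

/-- The graded module with components `ℳ` is graded simple. -/
def IsGradedSimpleModule (R : Type*) [Ring R] {κ V : Type*} [AddCommGroup V]
    [Module F V] [Module R V] (ℳ : κ → Submodule F V) : Prop :=
  (∃ v : V, v ≠ 0) ∧ ∀ W : Submodule R V, IsGradedSubmodule ℳ W → W = ⊥ ∨ W = ⊤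

/-- An `R`-module endomorphism of `V` is homogeneous of degree `d`. -/
def IsHomogeneousEnd {κ V : Type*} [Add κ] [AddCommGroup V] [Module F V]
    [Module R V] (ℳ : κ → Submodule F V) (d : κ) (f : Module.End R V) : Prop :=
  ∀ ⦃k : κ⦄ ⦃v : V⦄, v ∈ ℳ k → f v ∈ ℳ (k + d)

/-- The degree-`d` homogeneous component of the (graded) centralizer
`C(V) = End_R(V)`. -/
def homogComp {κ V : Type*} [Add κ] [AddCommGroup V] [Module F V] [Module R V]
    [SMulCommClass R F V] (ℳ : κ → Submodule F V) (d : κ) :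
    Submodule F (Module.End R V) where
  carrier := {f | IsHomogeneousEnd ℳ d f}
  add_mem' := fun hf hg k v hv => (ℳ _).add_mem (hf hv) (hg hv)
  zero_mem' := fun k v hv => (ℳ _).zero_mem
  smul_mem' := fun c f hf k v hv => by
    simpa using (ℳ _).smul_mem c (hf hv)

/-- `f` belongs to the graded centralizer: it is a finite sum of homogeneous
`R`-module endomorphisms. -/
def IsInGradedCentralizer {κ V : Type*} [Add κ] [AddCommGroup V] [Module F V]
    [Module R V] (ℳ : κ → Submodule F V) (f : Module.End R V) : Prop :=
  ∃ (t : Finset κ) (c : κ → Module.End R V),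
    (∀ d ∈ t, IsHomogeneousEnd ℳ d (c d)) ∧ f = ∑ d ∈ t, c d

/-- The module `V` is central (Schurian): its centralizer consists of the
scalar multiples of the identity. -/
def IsCentralModule (F : Type*) [Field F] (R V : Type*) [Ring R] [AddCommGroup V]
    [Module F V] [Module R V] : Prop :=
  ∀ f : Module.End R V, ∃ a : F, ∀ v : V, f v = a • v

/-- A graded subfield of a graded algebra with homogeneous components `𝒟`:
a graded unital subalgebra (given by its homogeneous components `comp`)
which is commutative and in which every nonzero homogeneous element is
invertible. -/
structure GradedSubfield {κ : Type*} [AddCommGroup κ] {A : Type*} [Ring A]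
    [Module F A] (𝒟 : κ → Submodule F A) where
  comp : κ → Submodule F A
  le : ∀ k, comp k ≤ 𝒟 k
  one_mem : (1 : A) ∈ comp 0
  mul_mem : ∀ {g h : κ} {a b : A}, a ∈ comp g → b ∈ comp h → a * b ∈ comp (g + h)
  comm : ∀ {g h : κ} {a b : A}, a ∈ comp g → b ∈ comp h → a * b = b * a
  inv_mem : ∀ {g : κ} {a : A}, a ∈ comp g → a ≠ 0 →
    ∃ b ∈ comp (-g), a * b = 1 ∧ b * a = 1

/-- The support of a graded subfield. -/
def GradedSubfield.support {κ : Type*} [AddCommGroup κ] {A : Type*} [Ring A]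
    [Module F A] {𝒟 : κ → Submodule F A} (𝒦 : GradedSubfield 𝒟) : Set κ :=
  {k | 𝒦.comp k ≠ ⊥}

/-- A graded subfield is maximal if the only graded subfield containing it
is itself. -/
def GradedSubfield.IsMaximal {κ : Type*} [AddCommGroup κ] {A : Type*} [Ring A]
    [Module F A] {𝒟 : κ → Submodule F A} (𝒦 : GradedSubfield 𝒟) : Prop :=
  ∀ 𝒦' : GradedSubfield 𝒟, (∀ k, 𝒦.comp k ≤ 𝒦'.comp k) → ∀ k, 𝒦'.comp k = 𝒦.comp k

/-- A graded subfield is isomorphic, as a graded algebra, to the group algebra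
of its support: it has a homogeneous basis `c` (one-dimensional components)
which is multiplicative. -/
def GradedSubfield.IsGroupAlgebraOfSupport {κ : Type*} [AddCommGroup κ]
    {A : Type*} [Ring A] [Module F A] {𝒟 : κ → Submodule F A}
    (𝒦 : GradedSubfield 𝒟) : Prop :=
  ∃ c : κ → A, c 0 = 1 ∧
    (∀ k ∈ 𝒦.support, c k ∈ 𝒦.comp k ∧ c k ≠ 0 ∧ 𝒦.comp k = Submodule.span F {c k}) ∧
    (∀ k₁ ∈ 𝒦.support, ∀ k₂ ∈ 𝒦.support, c (k₁ + k₂) = c k₁ * c k₂)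

section Loop

variable {Q₁ Q₂ : Type*}

/-- The underlying space of the loop module: inside `V ⊗ F[Q₁] ≅ (Q₁ →₀ V)`,
the subspace `⊕_{a ∈ Q₁} V_{s a} ⊗ a` of finitely supported functions `f` with
`f a ∈ V_{s a}`. -/
def LoopSubmodule {V : Type*} [AddCommGroup V] [Module F V] (s : Q₁ → Q₂)
    (ℳ : Q₂ → Submodule F V) : Submodule F (Q₁ →₀ V) where
  carrier := {f | ∀ a : Q₁, f a ∈ ℳ (s a)}
  add_mem' := fun hf hg a => by simpa using (ℳ _).add_mem (hf a) (hg a)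
  zero_mem' := fun a => by simpa using (ℳ _).zero_mem
  smul_mem' := fun c f hf a => by simpa using (ℳ _).smul_mem c (hf a)

/-- The degree-`a` homogeneous component of the loop module. -/
def loopComp {V : Type*} [AddCommGroup V] [Module F V] (s : Q₁ → Q₂)
    (ℳ : Q₂ → Submodule F V) (a : Q₁) : Submodule F ↥(LoopSubmodule s ℳ) where
  carrier := {x | ∀ b : Q₁, b ≠ a → (x : Q₁ →₀ V) b = 0}
  add_mem' := by
    intro x y hx hy b hb
    simp [hx b hb, hy b hb]
  zero_mem' := by intro b hb; simp
  smul_mem' := by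
    intro c x hx b hb
    simp [hx b hb]

/-- The scalar multiplication of a (possibly non-canonical) module structure,
written explicitly. -/
def msmul {S M : Type*} [Semiring S] [AddCommMonoid M] (i : Module S M)
    (r : S) (x : M) : M :=
  @SMul.smul S M i.toDistribMulAction.toMulAction.toSMul r x

/-- `i` is the loop-module `R`-action: a homogeneous element `r ∈ R_g` acts on
`v ⊗ a` by `r • (v ⊗ a) = (r v) ⊗ (p g + a)`; in terms of values of finitely
supported functions, `(r • x) a = r • x (a - p g)`. -/
def IsLoopSMul [AddCommGroup Q₁] (𝒜 : AlgebraGrading F G R) (p : G →+ Q₁)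
    (s : Q₁ → Q₂) {V : Type*} [AddCommGroup V] [Module F V] [Module R V]
    (ℳ : Q₂ → Submodule F V) (i : Module R ↥(LoopSubmodule s ℳ)) : Prop :=
  ∀ {g : G} {r : R}, r ∈ 𝒜.comp g → ∀ (x : ↥(LoopSubmodule s ℳ)) (a : Q₁),
    ((msmul i r x : ↥(LoopSubmodule s ℳ)) : Q₁ →₀ V) a = r • ((x : Q₁ →₀ V) (a - p g))

/-- The right-shift operator `1 ⊗ d` on the loop module:
`v ⊗ a ↦ v ⊗ (a + d)`. -/
def rshiftFun [AddCommGroup Q₁] {V : Type*} [AddCommGroup V] [Module F V]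
    (s : Q₁ → Q₂) (ℳ : Q₂ → Submodule F V) (d : Q₁) (hd : ∀ a, s (a + d) = s a) :
    ↥(LoopSubmodule s ℳ) → ↥(LoopSubmodule s ℳ) :=
  fun x => ⟨Finsupp.equivMapDomain (Equiv.addRight d) (x : Q₁ →₀ V), by
    intro a
    have key : Finsupp.equivMapDomain (Equiv.addRight d) (x : Q₁ →₀ V) a
        = (x : Q₁ →₀ V) (a - d) := by
      rw [Finsupp.equivMapDomain_apply]
      congr 1
      simp [sub_eq_add_neg]
    rw [key]
    have h1 : s (a - d) = s a := by
      have h2 := hd (a - d)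
      rw [show a - d + d = a by abel] at h2
      exact h2.symm
    exact h1 ▸ x.2 (a - d)⟩

end Loop

section Twist

variable (H : AddSubgroup G)

/-- `i` is the `R`-module structure on (the finitely-supported-functions model
`{f : G/H →₀ V | f q ∈ V_q}` of) the `G/H`-graded module `V`, twisted by the
scalar factors `cf`: a homogeneous `r ∈ R_g` acts on `v ∈ V_k` by
`r • v = cf g k • (r v) ∈ V_{ḡ + k}`. -/
def IsTwistedSMul (𝒜 : AlgebraGrading F G R) {V : Type*} [AddCommGroup V]
    [Module F V] [Module R V] (ℳ : G ⧸ H → Submodule F V) (cf : G → G ⧸ H → F)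
    (i : Module R ↥(LoopSubmodule (id : G ⧸ H → G ⧸ H) ℳ)) : Prop :=
  ∀ {g : G} {r : R}, r ∈ 𝒜.comp g → ∀ (x : ↥(LoopSubmodule (id : G ⧸ H → G ⧸ H) ℳ))
    (q : G ⧸ H),
    ((msmul i r x : ↥(LoopSubmodule (id : G ⧸ H → G ⧸ H) ℳ)) : (G ⧸ H) →₀ V) q
      = cf g (q - QuotientAddGroup.mk g) •
          (r • ((x : (G ⧸ H) →₀ V) (q - QuotientAddGroup.mk g)))

end Twist

section Pregrading

/-- A `G`-pregrading of the left `R`-module `V`: a family of subspaces with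
`V = Σ_g V_g` and `R_g · V_h ⊆ V_{g+h}`. -/
def IsPregrading (𝒜 : AlgebraGrading F G R) {V : Type*} [AddCommGroup V]
    [Module F V] [Module R V] (P : G → Submodule F V) : Prop :=
  (⨆ g, P g) = (⊤ : Submodule F V) ∧
  ∀ {g k : G} {r : R} {v : V}, r ∈ 𝒜.comp g → v ∈ P k → r • v ∈ P (g + k)

/-- A pregrading is thin if it admits no proper refinement. -/
def IsThinPregrading (𝒜 : AlgebraGrading F G R) {V : Type*} [AddCommGroup V]
    [Module F V] [Module R V] (P : G → Submodule F V) : Prop :=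
  IsPregrading 𝒜 P ∧
  ∀ P' : G → Submodule F V, IsPregrading 𝒜 P' → (∀ g, P' g ≤ P g) → P' = P

end Pregrading

section Extras

open TensorProduct

variable {G : Type*} [AddCommGroup G] {R : Type*} [Ring R] [Algebra F R]

lemma mk'_add_right_mem (H : AddSubgroup G) (h : ↥H) (a : G) :
    (QuotientAddGroup.mk' H) (a + (h : G)) = (QuotientAddGroup.mk' H) a := by
  simpa using QuotientAddGroup.mk_add_of_mem a h.2

/-- The right-shift operator `1 ⊗ h`, `h ∈ H`, on the loop module `L_π(V)`
(for `π : G → G/H` the natural projection): `v ⊗ g ↦ v ⊗ (g + h)`. -/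
def loopShift (H : AddSubgroup G) {V : Type*} [AddCommGroup V] [Module F V]
    (ℳ : G ⧸ H → Submodule F V) (h : ↥H) :
    ↥(LoopSubmodule (⇑(QuotientAddGroup.mk' H)) ℳ) →
      ↥(LoopSubmodule (⇑(QuotientAddGroup.mk' H)) ℳ) :=
  rshiftFun (⇑(QuotientAddGroup.mk' H)) ℳ (h : G) (mk'_add_right_mem H h)

lemma twist_elt_mem (H : AddSubgroup G) (ξ : G ⧸ H → G)
    (hξ : ∀ q, (QuotientAddGroup.mk' H) (ξ q) = q) (g : G) (k : G ⧸ H) :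
    g + ξ k - ξ ((QuotientAddGroup.mk' H) g + k) ∈ H := by
  have h0 : (QuotientAddGroup.mk' H) (g + ξ k - ξ ((QuotientAddGroup.mk' H) g + k)) = 0 := by
    rw [map_sub, map_add, hξ, hξ]
    abel
  exact (QuotientAddGroup.eq_zero_iff _).mp h0

/-- The scalar factors `χ(g + ξ(k̄) - ξ(ḡ + k̄))` defining the module `V`
twisted by a character `χ` of `H`, relative to the section `ξ` of the natural
projection `π : G → G/H`. -/
def twistFactor (H : AddSubgroup G) (ξ : G ⧸ H → G)
    (hξ : ∀ q, (QuotientAddGroup.mk' H) (ξ q) = q) (χ : AddChar ↥H Fˣ) :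
    G → G ⧸ H → F :=
  fun g k =>
    ((χ ⟨g + ξ k - ξ ((QuotientAddGroup.mk' H) g + k), twist_elt_mem H ξ hξ g k⟩ : Fˣ) : F)

/-- The `G/H`-grading induced on a quotient `W/N` of a `G`-graded module `W`:
the component of degree `ḡ` is the image of `⊕_{h ∈ H} W_{g+h}`. -/
def quotGradeComp {W : Type*} [AddCommGroup W] [Module F W] [Module R W]
    [IsScalarTower F R W] (H : AddSubgroup G) (ℳ : G → Submodule F W)
    (N : Submodule R W) : G ⧸ H → Submodule F (W ⧸ N) :=
  fun q => ⨆ g : {g : G // (QuotientAddGroup.mk' H) g = q},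
    (ℳ (g : G)).map ((N.mkQ).restrictScalars F)

/-- The submodule `W · ker ρ` of `W`, where `ρ` is the homomorphism of unital
algebras `𝓕 → F` determined by `ρ(c_h) = ρ h` on the multiplicative
homogeneous basis `c` of the graded subfield `𝓕 ≅ FH` of the centralizer:
`W · ker ρ = Σ_{h ∈ H} W·(c_h - ρ(h)·1)`. -/
def kerSubmodule {W : Type*} [AddCommGroup W] [Module F W] [Module R W]
    [SMulCommClass R F W] {H : AddSubgroup G} (c : ↥H → Module.End R W)
    (ρ : ↥H → F) : Submodule R W :=
  ⨆ h : ↥H, LinearMap.range (c h - ρ h • (1 : Module.End R W))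

/-- The grading of the coordinate space `ι' → F` with coordinates of degrees
`gdeg`. -/
def coordComp {ι' : Type*} (gdeg : ι' → G) (g : G) : Submodule F (ι' → F) where
  carrier := {x | ∀ i, gdeg i ≠ g → x i = 0}
  add_mem' := fun hx hy i hi => by
    simp only [Pi.add_apply, hx i hi, hy i hi, add_zero]
  zero_mem' := fun i hi => rfl
  smul_mem' := fun a x hx i hi => by
    simp only [Pi.smul_apply, hx i hi, smul_zero]

/-- The natural grading of a tensor product of two graded algebras (or graded
vector spaces): the component of degree `g` is spanned by the products
`a ⊗ b` of homogeneous elements with `deg a + deg b = g`. -/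
def tensorGradeComp {A B : Type*} [AddCommGroup A] [Module F A] [AddCommGroup B]
    [Module F B] (Ac : G → Submodule F A) (Bc : G → Submodule F B) (g : G) :
    Submodule F (A ⊗[F] B) :=
  Submodule.span F {x | ∃ (g₁ g₂ : G) (a : A) (b : B),
    g₁ + g₂ = g ∧ a ∈ Ac g₁ ∧ b ∈ Bc g₂ ∧ x = a ⊗ₜ[F] b}

/-- The action of `r ∈ R` on an `R`-module `V`, viewed as an `F`-linear
endomorphism of `V`; i.e. the representation `R → End_F(V)`. -/
def actionEnd (F : Type*) [Field F] {R V : Type*} [Ring R] [AddCommGroup V]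
    [Module F V] [Module R V] [SMulCommClass R F V] (r : R) : Module.End F V where
  toFun v := r • v
  map_add' := smul_add r
  map_smul' a v := by simpa using smul_comm r a v

end Extras

end GradedPaper

namespace GradedPaper

universe u_K

/-- A decomposition in the sense of `IsVSDecomp` is an internal direct sum. -/
lemma IsVSDecomp.isInternal {F V ι : Type*} [Field F] [DecidableEq ι] [AddCommGroup V]
    [Module F V] {ℳ : ι → Submodule F V} (h : IsVSDecomp ℳ) : DirectSum.IsInternal ℳ := by
  classical
  constructor
  · rw [injective_iff_map_eq_zero]
    intro x hx
    rw [DirectSum.coeAddMonoidHom_eq_dfinsuppSum] at hx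
    have h2 := h.2 x.support (fun i => (x i : V)) (fun i _ => (x i).2) hx
    ext i
    by_cases hi : i ∈ x.support
    · simpa using h2 i hi
    · simpa using hi
  · intro v
    obtain ⟨t, c, hc, rfl⟩ := h.1 v
    refine ⟨∑ i ∈ t.attach, DirectSum.of (fun i => ℳ i) i.1 ⟨c i.1, hc i.1 i.2⟩, ?_⟩
    rw [map_sum]
    simp only [DirectSum.coeAddMonoidHom_of]
    exact Finset.sum_attach t c

/-- Additive induction on homogeneous elements. -/
lemma IsVSDecomp.induct {F V ι : Type*} [Field F] [AddCommGroup V]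
    [Module F V] {ℳ : ι → Submodule F V} (h : IsVSDecomp ℳ) {P : V → Prop}
    (h0 : P 0) (hadd : ∀ x y, P x → P y → P (x + y))
    (hom : ∀ i, ∀ x ∈ ℳ i, P x) (v : V) : P v := by
  obtain ⟨t, c, hc, rfl⟩ := h.1 v
  exact Finset.sum_induction c P hadd h0 (fun i hi => hom i _ (hc i hi))

/-- Let `V` be a `G`-graded simple left `R`-module.  Then the
centralizer `C(V) = Hom_R(V,V)` coincides with the graded centralizer
`C^gr(V)`; that is, every `R`-module endomorphism of `V` is a finite sum of
homogeneous `R`-module endomorphisms. -/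
theorem statement0 {F : Type*} [Field F] {G : Type*} [AddCommGroup G]
    {R : Type*} [Ring R] [Algebra F R]
    {V : Type*} [AddCommGroup V] [Module F V] [Module R V] [IsScalarTower F R V]
    (𝒜 : AlgebraGrading F G R) (𝒱 : ModuleGrading 𝒜 (AddMonoidHom.id G) V)
    (hsimple : IsGradedSimpleModule R 𝒱.comp) (f : Module.End R V) :
    IsInGradedCentralizer 𝒱.comp f := by
  classical
  letI : DirectSum.Decomposition 𝒱.comp := 𝒱.decomp.isInternal.chooseDecomposition
  -- the projections
  let π : G → V →+ V := fun d =>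
    { toFun := fun v => (DirectSum.decompose 𝒱.comp v d : V)
      map_zero' := by simp
      map_add' := by intro x y; simp }
  have π_mem : ∀ d v, π d v ∈ 𝒱.comp d := fun d v =>
    (DirectSum.decompose 𝒱.comp v d).2
  have π_same : ∀ {d v}, v ∈ 𝒱.comp d → π d v = v := fun hv =>
    DirectSum.decompose_of_mem_same 𝒱.comp hv
  have π_ne : ∀ {d e v}, v ∈ 𝒱.comp d → d ≠ e → π e v = 0 := fun hv hne =>
    DirectSum.decompose_of_mem_ne 𝒱.comp hv hne
  have π_smul : ∀ {g : G} {r : R}, r ∈ 𝒜.comp g → ∀ (k : G) (w : V),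
      π (g + k) (r • w) = r • π k w := by
    intro g r hr k w
    induction w using 𝒱.decomp.induct with
    | h0 => simp
    | hadd x y hx hy => simp only [smul_add, map_add, hx, hy]
    | hom i x hx =>
      have hrx : r • x ∈ 𝒱.comp (g + i) := 𝒱.smul_mem hr hx
      by_cases hik : i = k
      · subst hik
        rw [π_same hrx, π_same hx]
      · rw [π_ne hrx (fun h => hik (add_left_cancel h)), π_ne hx hik, smul_zero]
  -- the homogeneous components of `f`, as additive maps
  let φ : G → V →+ V := fun d =>
    (DirectSum.toAddMonoid (fun k =>
      ((π (k + d)).comp f.toAddMonoidHom).comp (𝒱.comp k).subtype.toAddMonoidHom)).comp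
      (DirectSum.decomposeAddEquiv 𝒱.comp).toAddMonoidHom
  have φ_hom : ∀ d {k v}, v ∈ 𝒱.comp k → φ d v = π (k + d) (f v) := by
    intro d k v hv
    simp only [φ, AddMonoidHom.comp_apply]
    have : (DirectSum.decomposeAddEquiv 𝒱.comp).toAddMonoidHom v
        = DirectSum.of (fun i => 𝒱.comp i) k ⟨v, hv⟩ :=
      DirectSum.decompose_of_mem 𝒱.comp hv
    rw [this, DirectSum.toAddMonoid_of]
    rfl
  have φ_smul : ∀ d (r : R) (v : V), φ d (r • v) = r • φ d v := by
    intro d r v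
    induction r using 𝒜.decomp.induct with
    | h0 => simp
    | hadd x y hx hy => simp only [add_smul, map_add, hx, hy]
    | hom g r hr =>
      induction v using 𝒱.decomp.induct with
      | h0 => simp
      | hadd x y hx hy => simp only [smul_add, map_add, hx, hy]
      | hom k v hv =>
        have hrx : r • v ∈ 𝒱.comp (g + k) := 𝒱.smul_mem hr hv
        rw [φ_hom d hrx, φ_hom d hv, map_smul, add_assoc, π_smul hr]
  let Φ : G → Module.End R V := fun d =>
    { toFun := φ d
      map_add' := map_add (φ d)
      map_smul' := φ_smul d }
  -- a nonzero homogeneous vector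
  obtain ⟨k, u, hu, hu0⟩ : ∃ k, ∃ u ∈ 𝒱.comp k, u ≠ 0 := by
    by_contra hcon
    push Not at hcon
    obtain ⟨v, hv⟩ := hsimple.1
    exact hv (𝒱.decomp.induct (P := fun v => v = 0) rfl
      (fun x y hx hy => by rw [hx, hy, add_zero]) hcon v)
  have hspan : Submodule.span R {u} = ⊤ := by
    refine (hsimple.2 _ ?_).resolve_left ?_
    · intro w hw
      obtain ⟨r, rfl⟩ := Submodule.mem_span_singleton.1 hw
      obtain ⟨t, c, hc, rfl⟩ := 𝒜.decomp.1 r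
      refine ⟨t.map (Equiv.addRight k).toEmbedding, fun j => c (j - k) • u, ?_, ?_⟩
      · intro j hj
        obtain ⟨i, hi, rfl⟩ := Finset.mem_map.1 hj
        refine ⟨?_, Submodule.smul_mem _ _ (Submodule.mem_span_singleton_self u)⟩
        have := 𝒱.smul_mem (hc i hi) hu
        simpa using this
      · rw [Finset.sum_map, Finset.sum_smul]
        simp
    · rw [Submodule.span_singleton_eq_bot]
      exact hu0
  refine ⟨(DirectSum.decompose 𝒱.comp (f u)).support.map (Equiv.subRight k).toEmbedding, Φ, ?_, ?_⟩
  · intro d _ j v hv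
    change φ d v ∈ _
    rw [φ_hom d hv]
    exact π_mem _ _
  · refine LinearMap.ext_on hspan ?_
    intro x hx
    rw [Set.mem_singleton_iff.1 hx, LinearMap.sum_apply, Finset.sum_map]
    conv_lhs => rw [← DirectSum.sum_support_decompose 𝒱.comp (f u)]
    refine Finset.sum_congr rfl fun i _ => ?_
    change _ = φ (i - k) u
    rw [φ_hom _ hu, add_sub_cancel]
    rfl

end GradedPaper
end
end

section
/- (Graded density) Let V be a G-graded simple left R-module and let D = C(V) be its centralizer (so V is a right D-module). If v_1, …, v_n ∈ V are homogeneous elements that are linearly independent over D, then for any w_1, …, w_n ∈ V there exists an element r ∈ R such that r·v_i = w_i for i = 1, …, n. -/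
/-! Common definitions: gradings on algebras and modules, graded simplicity,
homogeneous endomorphisms, graded subfields, and loop modules. -/

noncomputable section

namespace GradedPaper

universe u_K

/-- The set `{r | r • xᵢ = 0 for all i} • y` is a graded submodule for homogeneous `xᵢ`, `y`. -/
lemma graded_ann_map {F : Type*} [Field F] {G : Type*} [AddCommGroup G]
    {R : Type*} [Ring R] [Algebra F R]
    {V : Type*} [AddCommGroup V] [Module F V] [Module R V] [IsScalarTower F R V]
    (𝒜 : AlgebraGrading F G R) (𝒱 : ModuleGrading 𝒜 (AddMonoidHom.id G) V)
    (n : ℕ) (x : Fin n → V) (hx : ∀ i, ∃ g : G, x i ∈ 𝒱.comp g)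
    (y : V) (hy : ∃ g : G, y ∈ 𝒱.comp g) (I : Submodule R R)
    (hI : ∀ r, r ∈ I ↔ ∀ i, r • x i = 0) :
    IsGradedSubmodule 𝒱.comp (I.map (LinearMap.toSpanSingleton R V y)) := by
  classical
  -- shifting the index of a homogeneous decomposition of `r`
  have shift : ∀ (t : Finset G) (c : G → R) (h : G) (z : V),
      ∑ k ∈ t.image (fun g => g + h), c (k - h) • z = (∑ g ∈ t, c g) • z := by
    intro t c h z
    rw [Finset.sum_image (fun a _ b _ hab => add_right_cancel hab), Finset.sum_smul]
    simp
  have shiftmem : ∀ (t : Finset G) (c : G → R) (h : G) (z : V), (∀ g ∈ t, c g ∈ 𝒜.comp g) →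
      z ∈ 𝒱.comp h → ∀ k ∈ t.image (fun g => g + h), c (k - h) • z ∈ 𝒱.comp k := by
    intro t c h z hc hz k hk
    obtain ⟨g, hg, rfl⟩ := Finset.mem_image.mp hk
    have := 𝒱.smul_mem (hc g hg) hz
    simpa using this
  rintro _ ⟨r, hr, rfl⟩
  obtain ⟨t, c, hc, hrc⟩ := 𝒜.decomp.1 r
  have hcI : ∀ g ∈ t, c g ∈ I := by
    intro g hg
    rw [hI]
    intro i
    obtain ⟨h, hh⟩ := hx i
    have h0 := 𝒱.decomp.2 (t.image (fun g => g + h)) (fun k => c (k - h) • x i)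
      (shiftmem t c h (x i) hc hh)
      (by rw [shift, ← hrc]; exact (hI r).1 hr i) (g + h) (Finset.mem_image_of_mem _ hg)
    simpa using h0
  obtain ⟨h, hh⟩ := hy
  refine ⟨t.image (fun g => g + h), fun k => c (k - h) • y, ?_, ?_⟩
  · intro k hk
    refine ⟨shiftmem t c h y hc hh k hk, ?_⟩
    obtain ⟨g, hg, rfl⟩ := Finset.mem_image.mp hk
    exact ⟨c g, hcI g hg, by simp⟩
  · rw [shift, ← hrc]
    simp

/-- Graded density.  Let `V` be a `G`-graded simple left
`R`-module with centralizer `D = C(V) = End_R(V)` (acting on the right, so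
`v · d = d v`).  If `v₁, …, vₙ` are homogeneous elements of `V` that are
linearly independent over `D`, then for any `w₁, …, wₙ ∈ V` there is `r ∈ R`
with `r • vᵢ = wᵢ` for all `i`. -/
theorem statement1 {F : Type*} [Field F] {G : Type*} [AddCommGroup G]
    {R : Type*} [Ring R] [Algebra F R]
    {V : Type*} [AddCommGroup V] [Module F V] [Module R V] [IsScalarTower F R V]
    (𝒜 : AlgebraGrading F G R) (𝒱 : ModuleGrading 𝒜 (AddMonoidHom.id G) V)
    (hsimple : IsGradedSimpleModule R 𝒱.comp)
    (n : ℕ) (v : Fin n → V) (hhomog : ∀ i, ∃ g : G, v i ∈ 𝒱.comp g)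
    (hindep : ∀ d : Fin n → Module.End R V, (∑ i, (d i) (v i)) = 0 → ∀ i, d i = 0)
    (w : Fin n → V) :
    ∃ r : R, ∀ i, r • v i = w i := by
  induction n with
  | zero => exact ⟨0, fun i => i.elim0⟩
  | succ n ih =>
    have ih' := ih (fun i => v i.castSucc) (fun i => hhomog _) (by
      intro d hd i
      have := hindep (Fin.snoc d 0) (by simpa [Fin.sum_univ_castSucc] using hd) i.castSucc
      simpa using this)
    let f : R →ₗ[R] (Fin n → V) :=
      LinearMap.pi (fun i => LinearMap.toSpanSingleton R V (v i.castSucc))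
    let g : R →ₗ[R] V := LinearMap.toSpanSingleton R V (v (Fin.last n))
    have hf : Function.Surjective f := by
      intro u
      obtain ⟨r, hr⟩ := ih' u
      exact ⟨r, funext fun i => by simpa [f] using hr i⟩
    have hgr : IsGradedSubmodule 𝒱.comp ((LinearMap.ker f).map g) :=
      graded_ann_map 𝒜 𝒱 n (fun i => v i.castSucc) (fun i => hhomog _) (v (Fin.last n))
        (hhomog _) (LinearMap.ker f) (by
          intro r
          simp [f, funext_iff])
    rcases hsimple.2 _ hgr with h | h
    · exfalso
      have hle : LinearMap.ker f ≤ LinearMap.ker g := by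
        intro r hr
        have : g r ∈ (LinearMap.ker f).map g := ⟨r, hr, rfl⟩
        rw [h] at this
        simpa using this
      let φ : (Fin n → V) →ₗ[R] V :=
        ((LinearMap.ker f).liftQ g hle).comp (f.quotKerEquivOfSurjective hf).symm.toLinearMap
      have hφ : φ (f 1) = g 1 := by
        have : (f.quotKerEquivOfSurjective hf).symm (f 1) = Submodule.Quotient.mk 1 := by
          rw [LinearEquiv.symm_apply_eq]
          rfl
        simp only [φ, LinearMap.comp_apply, LinearEquiv.coe_coe, this]
        exact Submodule.liftQ_apply _ _ _
      have hsum : φ (f 1) = ∑ i, φ (Pi.single i (v i.castSucc)) := by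
        rw [← map_sum, Finset.univ_sum_single]
        congr 1
        ext i
        simp [f]
      have hz := hindep
        (Fin.snoc (fun i => φ.comp (LinearMap.single R (fun _ => V) i)) (-1)) (by
          have e : ∑ i, φ (Pi.single i (v i.castSucc)) = v (Fin.last n) := by
            rw [← hsum, hφ]; simp [g]
          simp [Fin.sum_univ_castSucc, e]) (Fin.last n)
      obtain ⟨u, hu⟩ := hsimple.1
      apply hu
      have := LinearMap.congr_fun hz u
      simpa using this
    · obtain ⟨r, hr⟩ := ih' (fun i => w i.castSucc)
      have hm : w (Fin.last n) - r • v (Fin.last n) ∈ (LinearMap.ker f).map g := by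
        rw [h]; trivial
      obtain ⟨s, hs, hsg⟩ := hm
      have hs' : ∀ i : Fin n, s • v i.castSucc = 0 := by
        intro i
        have := congr_fun (LinearMap.mem_ker.mp hs) i
        simpa [f] using this
      have hsg' : s • v (Fin.last n) = w (Fin.last n) - r • v (Fin.last n) := by
        simpa [g] using hsg
      refine ⟨r + s, fun i => ?_⟩
      induction i using Fin.lastCases with
      | last => rw [add_smul, hsg']; abel
      | cast i => rw [add_smul, hs', add_zero]; exact hr i


end GradedPaper
end
end

section
/- A G-graded left R-module W is isomorphic, as a G-graded R-module, to a loop module L_π(V) for some Ḡ-graded left R-module V if and only if the graded centralizer C^gr(W) contains a graded subfield that is isomorphic to the group algebra FH as a G-graded algebra. -/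
/-! Common definitions: gradings on algebras and modules, graded simplicity,
homogeneous endomorphisms, graded subfields, and loop modules. -/

noncomputable section

namespace GradedPaper

section Helpers

variable {F : Type*} [Field F]

lemma IsVSDecomp.ind {V ι : Type*} [AddCommGroup V] [Module F V]
    {ℳ : ι → Submodule F V} (h : IsVSDecomp ℳ) (p : V → Prop)
    (h0 : p 0) (ha : ∀ x y, p x → p y → p (x + y))
    (hm : ∀ i, ∀ x ∈ ℳ i, p x) (v : V) : p v := by
  obtain ⟨t, c, hc, rfl⟩ := h.1 v
  exact Finset.sum_induction c p ha h0 (fun i hi => hm i _ (hc i hi))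

lemma IsVSDecomp.exists_proj {V ι : Type*} [AddCommGroup V] [Module F V]
    {ℳ : ι → Submodule F V} (h : IsVSDecomp ℳ) :
    ∃ P : V →ₗ[F] (ι →₀ V), (∀ v i, P v i ∈ ℳ i) ∧
      (∀ i, ∀ v ∈ ℳ i, P v = Finsupp.single i v) ∧
      (∀ f : ι →₀ V, (∀ i, f i ∈ ℳ i) → P (f.sum fun _ x => x) = f) ∧
      ∀ v, ((P v).sum fun _ x => x) = v := by
  classical
  let S : ↥(LoopSubmodule (id : ι → ι) ℳ) →ₗ[F] V :=
    (Finsupp.lsum F (fun _ : ι => (LinearMap.id : V →ₗ[F] V))) ∘ₗ Submodule.subtype _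
  have hS : ∀ x, S x = (x : ι →₀ V).sum fun _ x => x := fun x => rfl
  have hinj : Function.Injective S := by
    rw [← LinearMap.ker_eq_bot, LinearMap.ker_eq_bot']
    intro x hx
    rw [hS] at hx
    have := h.2 (x : ι →₀ V).support (x : ι →₀ V) (fun i _ => x.2 i) hx
    ext i
    by_cases hi : i ∈ (x : ι →₀ V).support
    · simpa using this i hi
    · simpa using hi
  have hsing : ∀ i, ∀ v ∈ ℳ i, Finsupp.single i v ∈ LoopSubmodule (id : ι → ι) ℳ := by
    intro i v hv j
    by_cases hij : i = j
    · subst hij; simpa using hv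
    · rw [Finsupp.single_eq_of_ne' hij]; exact (ℳ _).zero_mem
  have hsurj : Function.Surjective S := by
    rw [← LinearMap.range_eq_top, eq_top_iff]
    intro v _
    refine h.ind (fun v => v ∈ LinearMap.range S) (Submodule.zero_mem _)
      (fun x y hx hy => Submodule.add_mem _ hx hy) ?_ v
    intro i x hx
    exact ⟨⟨_, hsing i x hx⟩, by rw [hS]; simp⟩
  let e := LinearEquiv.ofBijective S ⟨hinj, hsurj⟩
  have key : ∀ f (hf : f ∈ LoopSubmodule (id : ι → ι) ℳ),
      ((e.symm (f.sum fun _ x => x) : ↥(LoopSubmodule (id : ι → ι) ℳ)) : ι →₀ V) = f := by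
    intro f hf
    have : e.symm (f.sum fun _ x => x) = ⟨f, hf⟩ := by
      rw [LinearEquiv.symm_apply_eq]
      exact (hS ⟨f, hf⟩).symm
    rw [this]
  refine ⟨Submodule.subtype _ ∘ₗ e.symm.toLinearMap, ?_, ?_, ?_, ?_⟩
  · intro v i
    exact (e.symm v).2 i
  · intro i v hv
    have := key _ (hsing i v hv)
    simpa using this
  · intro f hf
    exact key f hf
  · intro v
    have := hS (e.symm v)
    have h2 : S (e.symm v) = v := e.apply_symm_apply v
    rw [h2] at this
    exact this.symm

lemma rshift_apply {G Q₂ : Type*} [AddCommGroup G] {V : Type*} [AddCommGroup V] [Module F V]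
    (s : G → Q₂) (ℳ : Q₂ → Submodule F V) (d : G) (hd : ∀ a, s (a + d) = s a)
    (x : ↥(LoopSubmodule s ℳ)) (a : G) :
    ((rshiftFun s ℳ d hd x : ↥(LoopSubmodule s ℳ)) : G →₀ V) a = (x : G →₀ V) (a - d) := by
  simp [rshiftFun, Finsupp.equivMapDomain_apply, sub_eq_add_neg]

theorem forward {G : Type*} [AddCommGroup G]
    {R : Type*} [Ring R] [Algebra F R] (H : AddSubgroup G)
    {W : Type*} [AddCommGroup W] [Module F W] [Module R W] [IsScalarTower F R W]
    (𝒜 : AlgebraGrading F G R) (𝒲 : ModuleGrading 𝒜 (AddMonoidHom.id G) W)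
    {V : Type*} [AddCommGroup V] [Module F V] [Module R V]
    (ℳ : G ⧸ H → Submodule F V)
    (iL : Module R ↥(LoopSubmodule (⇑(QuotientAddGroup.mk' H)) ℳ))
    (hL : IsLoopSMul 𝒜 (AddMonoidHom.id G) (⇑(QuotientAddGroup.mk' H)) ℳ iL)
    (e : W ≃ₗ[R] ↥(LoopSubmodule (⇑(QuotientAddGroup.mk' H)) ℳ))
    (h1 : ∀ g : G, ∀ w ∈ 𝒲.comp g, e w ∈ loopComp (⇑(QuotientAddGroup.mk' H)) ℳ g)
    (h2 : ∀ g : G, ∀ x ∈ loopComp (⇑(QuotientAddGroup.mk' H)) ℳ g, e.symm x ∈ 𝒲.comp g) :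
    (∃ c : ↥H → Module.End R W,
      c 0 = 1 ∧
      (∀ h : ↥H, IsHomogeneousEnd 𝒲.comp ((h : G)) (c h)) ∧
      (∀ h₁ h₂ : ↥H, c (h₁ + h₂) = c h₁ * c h₂)) := by
  have sh : ∀ (h : ↥H) x a, ((loopShift H ℳ h x :
      ↥(LoopSubmodule (⇑(QuotientAddGroup.mk' H)) ℳ)) : G →₀ V) a = (x : G →₀ V) (a - h) :=
    fun h x a => rshift_apply _ _ _ _ x a
  have hadd : ∀ (h : ↥H) x y, loopShift H ℳ h (x + y) = loopShift H ℳ h x + loopShift H ℳ h y := by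
    intro h x y
    ext a
    change _ = (loopShift H ℳ h x : G →₀ V) a + (loopShift H ℳ h y : G →₀ V) a
    rw [sh, sh, sh]
    rfl
  have hsm : ∀ (h : ↥H) (r : R) x, loopShift H ℳ h (r • x) = r • loopShift H ℳ h x := by
    intro h r
    refine 𝒜.decomp.ind (fun r => ∀ x, loopShift H ℳ h (r • x) = r • loopShift H ℳ h x)
      ?_ ?_ ?_ r
    · intro x
      rw [zero_smul, zero_smul]
      ext a
      simp [sh]
    · intro r s hr hs x
      rw [add_smul, add_smul, hadd, hr, hs]
    · intro g r hr x
      have hL' : ∀ x a, ((r • x : ↥(LoopSubmodule (⇑(QuotientAddGroup.mk' H)) ℳ)) : G →₀ V) a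
        = r • ((x : G →₀ V) (a - g)) := fun x a => hL hr x a
      ext a
      rw [sh, hL', hL', sh, sub_right_comm]
  let S : ↥H → ↥(LoopSubmodule (⇑(QuotientAddGroup.mk' H)) ℳ) →ₗ[R]
      ↥(LoopSubmodule (⇑(QuotientAddGroup.mk' H)) ℳ) := fun h =>
    { toFun := loopShift H ℳ h, map_add' := hadd h, map_smul' := hsm h }
  have hS : ∀ h x, S h x = loopShift H ℳ h x := fun _ _ => rfl
  refine ⟨fun h => e.symm.toLinearMap ∘ₗ S h ∘ₗ e.toLinearMap, ?_, ?_, ?_⟩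
  · ext w
    have : S 0 (e w) = e w := by
      ext a
      rw [hS, sh]; simp
    change e.symm (S 0 (e w)) = w
    rw [this, e.symm_apply_apply]
  · intro h k v hv
    refine h2 _ _ ?_
    intro b hb
    change ((S h (e v) : ↥(LoopSubmodule (⇑(QuotientAddGroup.mk' H)) ℳ)) : G →₀ V) b = 0
    rw [hS, sh]
    refine h1 k v hv _ ?_
    intro hh
    exact hb (by rw [← hh]; abel)
  · intro a b
    ext w
    have : S (a + b) (e w) = S a (S b (e w)) := by
      ext g
      rw [hS, hS, hS, sh, sh, sh, AddSubgroup.coe_add, sub_sub]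
    change e.symm (S (a + b) (e w)) = e.symm (S a (e (e.symm (S b (e w)))))
    rw [this, e.apply_symm_apply]

theorem backward {F : Type*} [Field F] {G : Type*} [AddCommGroup G]
    {R : Type*} [Ring R] [Algebra F R] (H : AddSubgroup G)
    {W : Type*} [AddCommGroup W] [Module F W] [Module R W] [IsScalarTower F R W]
    (𝒜 : AlgebraGrading F G R) (𝒲 : ModuleGrading 𝒜 (AddMonoidHom.id G) W)
    (c : ↥H → Module.End R W) (c0 : c 0 = 1)
    (ch : ∀ h : ↥H, IsHomogeneousEnd 𝒲.comp ((h : G)) (c h))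
    (cm : ∀ h₁ h₂ : ↥H, c (h₁ + h₂) = c h₁ * c h₂) :
    ∃ (N : Submodule R W)
        (𝒱 : ModuleGrading 𝒜 (QuotientAddGroup.mk' H) (W ⧸ N))
        (iL : Module R ↥(LoopSubmodule (⇑(QuotientAddGroup.mk' H)) 𝒱.comp)),
      IsLoopSMul 𝒜 (AddMonoidHom.id G) (⇑(QuotientAddGroup.mk' H)) 𝒱.comp iL ∧
      ∃ e : W ≃ₗ[R] ↥(LoopSubmodule (⇑(QuotientAddGroup.mk' H)) 𝒱.comp),
        (∀ g : G, ∀ w ∈ 𝒲.comp g,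
          e w ∈ loopComp (⇑(QuotientAddGroup.mk' H)) 𝒱.comp g) ∧
        (∀ g : G, ∀ x ∈ loopComp (⇑(QuotientAddGroup.mk' H)) 𝒱.comp g,
          e.symm x ∈ 𝒲.comp g) := by
  classical
  obtain ⟨P, P1, P2, P3, P4⟩ := 𝒲.decomp.exists_proj
  obtain ⟨ξ, hξ⟩ : ∃ ξ : G ⧸ H → G, ∀ q, QuotientAddGroup.mk' H (ξ q) = q :=
    ⟨fun q => q.out, fun q => by simp⟩
  have hd : ∀ g, ξ (QuotientAddGroup.mk' H g) - g ∈ H := fun g => by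
    rw [← QuotientAddGroup.eq_zero_iff, ← QuotientAddGroup.mk'_apply, map_sub, hξ, sub_self]
  let d : G → ↥H := fun g => ⟨_, hd g⟩
  have dcoe : ∀ g, (d g : G) = ξ (QuotientAddGroup.mk' H g) - g := fun g => rfl
  have cc : ∀ a b w, c a (c b w) = c (a + b) w := fun a b w => by rw [cm]; rfl
  have c0' : ∀ w, c 0 w = w := fun w => by rw [c0]; rfl
  have hcd : ∀ g, ∀ w ∈ 𝒲.comp g, c (d g) w ∈ 𝒲.comp (ξ (QuotientAddGroup.mk' H g)) := by
    intro g w hw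
    have := ch (d g) hw
    rwa [dcoe, add_sub_cancel] at this
  have hcd' : ∀ g, ∀ w ∈ 𝒲.comp (ξ (QuotientAddGroup.mk' H g)), c (-d g) w ∈ 𝒲.comp g := by
    intro g w hw
    have := ch (-d g) hw
    rwa [AddSubgroup.coe_neg, dcoe, neg_sub, add_sub_cancel] at this
  let Φ : W →ₗ[F] (G ⧸ H →₀ W) := (Finsupp.lsum F (fun g : G =>
    (Finsupp.lsingle (QuotientAddGroup.mk' H g) : W →ₗ[F] (G ⧸ H →₀ W)) ∘ₗ
      (c (d g)).restrictScalars F)) ∘ₗ P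
  have hΦ : ∀ g, ∀ w ∈ 𝒲.comp g,
      Φ w = Finsupp.single (QuotientAddGroup.mk' H g) (c (d g) w) := by
    intro g w hw
    simp [Φ, P2 g w hw]
  have hΦξ : ∀ q, ∀ w ∈ 𝒲.comp (ξ q), Φ w = Finsupp.single q w := by
    intro q w hw
    have h0 : d (ξ q) = 0 := by
      ext
      rw [dcoe, hξ]; simp
    rw [hΦ _ _ hw, hξ, h0, c0']
  have hΦc : ∀ h w, Φ (c h w) = Φ w := by
    intro h w
    refine 𝒲.decomp.ind (fun w => Φ (c h w) = Φ w) (by simp)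
      (fun x y hx hy => by simp only [map_add, hx, hy]) ?_ w
    intro g w hw
    have hg : QuotientAddGroup.mk' H (g + h) = QuotientAddGroup.mk' H g := mk'_add_right_mem H h g
    have h1 : d (g + h) + h = d g := by
      ext
      rw [AddSubgroup.coe_add, dcoe, dcoe, hg]; abel
    rw [hΦ _ _ (ch h hw), hΦ _ _ hw, cc, h1, hg]
  let N : Submodule R W := ⨆ h : ↥H, LinearMap.range (c h - 1)
  have hN : ∀ w ∈ N, Φ w = 0 := by
    intro w hw
    refine Submodule.iSup_induction _ (motive := fun w => Φ w = 0) hw ?_ (map_zero _)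
      (fun x y hx hy => by rw [map_add, hx, hy, add_zero])
    rintro h _ ⟨w, rfl⟩
    rw [LinearMap.sub_apply, map_sub, hΦc, Module.End.one_apply, sub_self]
  let q : W →ₗ[R] W ⧸ N := N.mkQ
  have qc : ∀ h w, q (c h w) = q w := by
    intro h w
    rw [← sub_eq_zero, ← map_sub]
    refine (Submodule.Quotient.mk_eq_zero N).2 ?_
    exact Submodule.mem_iSup_of_mem h ⟨w, rfl⟩
  have q0 : ∀ w, q w = 0 → Φ w = 0 := fun w hw =>
    hN w ((Submodule.Quotient.mk_eq_zero N).1 hw)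
  have qhom : ∀ g, ∀ w ∈ 𝒲.comp g, q w = 0 → w = 0 := by
    intro g w hw h
    have := q0 w h
    rw [hΦ g w hw, Finsupp.single_eq_zero] at this
    rw [← c0' w, ← neg_add_cancel (d g), ← cc, this, map_zero]
  have qs : Function.Surjective q := Submodule.mkQ_surjective N
  have hΦq : ∀ w, q w = (Φ w).sum (fun _ x => q x) := by
    intro w
    refine 𝒲.decomp.ind (fun w => q w = (Φ w).sum (fun _ x => q x)) (by simp) ?_ ?_ w
    · intro x y hx hy
      rw [map_add, map_add, Finsupp.sum_add_index' (by simp) (by simp), ← hx, ← hy]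
    · intro g w hw
      rw [hΦ g w hw, Finsupp.sum_single_index (h := fun _ x => q x) (map_zero q), qc]
  have hΦmem : ∀ w k, Φ w k ∈ 𝒲.comp (ξ k) := by
    intro w k
    refine 𝒲.decomp.ind (fun w => Φ w k ∈ 𝒲.comp (ξ k)) (by simp)
      (fun x y hx hy => by rw [map_add]; exact Submodule.add_mem _ hx hy) ?_ w
    intro g w hw
    rw [hΦ g w hw]
    by_cases hk : QuotientAddGroup.mk' H g = k
    · subst hk; rw [Finsupp.single_eq_same]; exact hcd g w hw
    · rw [Finsupp.single_eq_of_ne' hk]; exact Submodule.zero_mem _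
  let C : G ⧸ H → Submodule F (W ⧸ N) := fun k => (𝒲.comp (ξ k)).map (q.restrictScalars F)
  have hC : ∀ g, ∀ w ∈ 𝒲.comp g, q w ∈ C (QuotientAddGroup.mk' H g) := fun g w hw =>
    ⟨_, hcd g w hw, qc _ _⟩
  have hC' : ∀ g, ∀ v ∈ C (QuotientAddGroup.mk' H g), ∃ w ∈ 𝒲.comp g, q w = v := by
    rintro g _ ⟨w, hw, rfl⟩
    exact ⟨_, hcd' g w hw, qc _ _⟩
  let 𝒱 : ModuleGrading 𝒜 (QuotientAddGroup.mk' H) (W ⧸ N) :=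
    { comp := C
      decomp := by
        constructor
        · intro v
          obtain ⟨w, rfl⟩ := qs v
          exact ⟨(Φ w).support, fun k => q (Φ w k), fun k _ => ⟨_, hΦmem w k, rfl⟩, hΦq w⟩
        · intro t f hf h0
          have : ∀ k, ∃ w, k ∈ t → w ∈ 𝒲.comp (ξ k) ∧ q w = f k := by
            intro k
            by_cases hk : k ∈ t
            · obtain ⟨w, hw, hw'⟩ := hf k hk
              exact ⟨w, fun _ => ⟨hw, hw'⟩⟩
            · exact ⟨0, fun h => absurd h hk⟩
          choose w hw using this
          have h1 : q (∑ k ∈ t, w k) = 0 := by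
            rw [map_sum, ← h0]
            exact Finset.sum_congr rfl fun k hk => (hw k hk).2
          have h2 := q0 _ h1
          rw [map_sum, Finset.sum_congr rfl fun k hk => hΦξ k (w k) (hw k hk).1] at h2
          intro i hi
          have h3 := DFunLike.congr_fun h2 i
          rw [Finsupp.finsetSum_apply, Finset.sum_eq_single_of_mem i hi
            (fun b _ hb => Finsupp.single_eq_of_ne' hb), Finsupp.single_eq_same] at h3
          rw [← (hw i hi).2, h3]; simp
      smul_mem := by
        rintro g k r _ hr ⟨w, hw, rfl⟩
        have h1 := hC _ _ (𝒲.smul_mem hr hw)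
        rw [map_add, hξ] at h1
        rw [LinearMap.restrictScalars_apply, ← map_smul]
        exact h1 }
  let L := LoopSubmodule (⇑(QuotientAddGroup.mk' H)) 𝒱.comp
  let E : W →ₗ[F] ↥L := LinearMap.codRestrict L
    (Finsupp.mapRange.linearMap (q.restrictScalars F) ∘ₗ P) (fun w g => by
      simpa using hC g _ (P1 w g))
  have hE : ∀ w g, (E w : G →₀ W ⧸ N) g = q (P w g) := fun w g => rfl
  have Einj : Function.Injective E := by
    rw [← LinearMap.ker_eq_bot, LinearMap.ker_eq_bot']
    intro w hw
    have : P w = 0 := by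
      ext g
      refine qhom g _ (P1 w g) ?_
      rw [← hE, hw]; rfl
    rw [← P4 w, this]; simp
  have Esurj : Function.Surjective E := by
    intro x
    have : ∀ g, ∃ w ∈ 𝒲.comp g, q w = (x : G →₀ W ⧸ N) g ∧ ((x : G →₀ W ⧸ N) g = 0 → w = 0) := by
      intro g
      obtain ⟨w, hw, hw'⟩ := hC' g _ (x.2 g)
      exact ⟨w, hw, hw', fun h => qhom g w hw (hw'.trans h)⟩
    choose w hw1 hw2 hw3 using this
    let f : G →₀ W := Finsupp.onFinset (x : G →₀ W ⧸ N).support w (fun g hg => by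
      rw [Finsupp.mem_support_iff]; exact fun h => hg (hw3 g h))
    refine ⟨f.sum fun _ x => x, ?_⟩
    ext g
    rw [hE, P3 f hw1]
    exact hw2 g
  let E' : W ≃ₗ[F] ↥L := LinearEquiv.ofBijective E ⟨Einj, Esurj⟩
  have hE' : ∀ w, E' w = E w := fun _ => rfl
  letI sL : SMul R ↥L := ⟨fun r x => E' (r • E'.symm x)⟩
  have sdef : ∀ (r : R) (x : ↥L), r • x = E' (r • E'.symm x) := fun _ _ => rfl
  letI iL : Module R ↥L := Function.Injective.module R
    (E'.symm.toLinearMap.toAddMonoidHom) E'.symm.injective (fun r x => by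
      change E'.symm (r • x) = r • E'.symm x
      rw [sdef, E'.symm_apply_apply])
  have Psm : ∀ g, ∀ r ∈ 𝒜.comp g, ∀ w a, P (r • w) a = r • P w (a - g) := by
    intro g r hr w a
    refine 𝒲.decomp.ind (fun w => P (r • w) a = r • P w (a - g)) (by simp)
      (fun x y hx hy => by simp only [smul_add, map_add, Finsupp.add_apply, hx, hy]) ?_ w
    intro k w hw
    rw [P2 k w hw, P2 _ _ (𝒲.smul_mem hr hw), AddMonoidHom.id_apply]
    by_cases hk : a = g + k
    · subst hk
      rw [Finsupp.single_eq_same, add_sub_cancel_left, Finsupp.single_eq_same]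
    · rw [Finsupp.single_eq_of_ne hk, Finsupp.single_eq_of_ne, smul_zero]
      intro h
      exact hk (by rw [← h]; abel)
  refine ⟨N, 𝒱, iL, ?_, ?_⟩
  · intro g r hr x a
    obtain ⟨w, rfl⟩ := E'.surjective x
    change ((E' (r • E'.symm (E' w)) : ↥L) : G →₀ W ⧸ N) a = _
    rw [E'.symm_apply_apply, hE', hE', hE, hE, Psm g r hr, map_smul, AddMonoidHom.id_apply]
  · let e : W ≃ₗ[R] ↥L :=
      { E' with
        map_smul' := fun r w => by
          change E' (r • w) = E' (r • E'.symm (E' w))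
          rw [E'.symm_apply_apply] }
    have he : ∀ w, e w = E w := fun _ => rfl
    refine ⟨e, ?_, ?_⟩
    · intro g w hw b hb
      rw [he, hE, P2 g w hw, Finsupp.single_eq_of_ne hb, map_zero]
    · intro g x hx
      obtain ⟨w, rfl⟩ := e.surjective x
      rw [e.symm_apply_apply]
      have : P w = Finsupp.single g (P w g) := by
        ext b
        by_cases hb : b = g
        · subst hb; simp
        · rw [Finsupp.single_eq_of_ne hb]
          refine qhom b _ (P1 w b) ?_
          rw [← hE, ← he]
          exact hx b hb
      rw [← P4 w, this, Finsupp.sum_single_index rfl]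
      exact P1 w g

end Helpers

universe u₁ u₂ u₃ u₄

/-- A `G`-graded left `R`-module `W` is isomorphic, as a
`G`-graded `R`-module, to a loop module `L_π(V)` for some `G/H`-graded left
`R`-module `V` if and only if the graded centralizer `C^gr(W)` contains a
graded subfield isomorphic to the group algebra `FH` as a `G`-graded algebra,
i.e. iff there is a multiplicative family `(c_h)_{h ∈ H}` of homogeneous
`R`-endomorphisms of `W` with `deg c_h = h` and `c_0 = 1`. -/
theorem statement3 {F : Type u₁} [Field F] {G : Type u₂} [AddCommGroup G]
    {R : Type u₃} [Ring R] [Algebra F R] (H : AddSubgroup G)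
    {W : Type u₄} [AddCommGroup W] [Module F W] [Module R W] [IsScalarTower F R W]
    (𝒜 : AlgebraGrading F G R) (𝒲 : ModuleGrading 𝒜 (AddMonoidHom.id G) W) :
    (∃ (V : Type u₄) (_ : AddCommGroup V) (_ : Module F V) (_ : Module R V)
        (_ : IsScalarTower F R V)
        (𝒱 : ModuleGrading 𝒜 (QuotientAddGroup.mk' H) V)
        (iL : Module R ↥(LoopSubmodule (⇑(QuotientAddGroup.mk' H)) 𝒱.comp)),
      IsLoopSMul 𝒜 (AddMonoidHom.id G) (⇑(QuotientAddGroup.mk' H)) 𝒱.comp iL ∧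
      ∃ e : W ≃ₗ[R] ↥(LoopSubmodule (⇑(QuotientAddGroup.mk' H)) 𝒱.comp),
        (∀ g : G, ∀ w ∈ 𝒲.comp g,
          e w ∈ loopComp (⇑(QuotientAddGroup.mk' H)) 𝒱.comp g) ∧
        (∀ g : G, ∀ x ∈ loopComp (⇑(QuotientAddGroup.mk' H)) 𝒱.comp g,
          e.symm x ∈ 𝒲.comp g))
    ↔
    (∃ c : ↥H → Module.End R W,
      c 0 = 1 ∧
      (∀ h : ↥H, IsHomogeneousEnd 𝒲.comp ((h : G)) (c h)) ∧
      (∀ h₁ h₂ : ↥H, c (h₁ + h₂) = c h₁ * c h₂)) := by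
  constructor
  · rintro ⟨V, i1, i2, i3, i4, 𝒱, iL, hL, e, h1, h2⟩
    exact forward H 𝒜 𝒲 𝒱.comp iL hL e h1 h2
  · rintro ⟨c, c0, ch, cm⟩
    obtain ⟨N, 𝒱, iL, h⟩ := backward H 𝒜 𝒲 c c0 ch cm
    exact ⟨W ⧸ N, inferInstance, inferInstance, inferInstance, inferInstance, 𝒱, iL, h⟩

end GradedPaper
end
end

section
/- Assume F is algebraically closed. Let W be a G-graded simple left R-module that is graded central, i.e., C(W)_e = F·id_W. Then for any graded subfield 𝓚 of C(W), the support K = {g ∈ G : 𝓚_g ≠ 0} is a subgroup of G, each nonzero homogeneous component of 𝓚 is one-dimensional, and 𝓚 is isomorphic to the group algebra FK as a G-graded algebra. -/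
/-! Common definitions: gradings on algebras and modules, graded simplicity,
homogeneous endomorphisms, graded subfields, and loop modules. -/

noncomputable section

namespace GradedPaper

universe u_K

theorem exists_retraction_units {F : Type*} [Field F] [IsAlgClosed F] {P : Type*} [CommGroup P]
    (f : Fˣ →* P) (hf : Function.Injective f) : ∃ r : P →* Fˣ, ∀ a, r (f a) = a := by
  have hroot : ∀ {n : ℤ}, n ≠ 0 → Function.Surjective (fun a : Additive Fˣ => n • a) := by
    have hpos : ∀ n : ℕ, n ≠ 0 → ∀ a : Fˣ, ∃ b : Fˣ, b ^ n = a := by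
      intro n hn a
      obtain ⟨z, hz⟩ := IsAlgClosed.exists_pow_nat_eq (a : F) (Nat.pos_of_ne_zero hn)
      have hz0 : z ≠ 0 := by
        rintro rfl
        rw [zero_pow hn] at hz
        exact a.ne_zero hz.symm
      exact ⟨Units.mk0 z hz0, Units.ext (by simpa using hz)⟩
    intro n hn a
    obtain ⟨m, rfl | rfl⟩ := n.eq_nat_or_neg
    · obtain ⟨b, hb⟩ := hpos m (by simpa using hn) a.toMul
      refine ⟨Additive.ofMul b, ?_⟩
      apply Additive.toMul.injective
      simpa using hb
    · obtain ⟨b, hb⟩ := hpos m (by simpa using hn) a.toMul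
      refine ⟨Additive.ofMul b⁻¹, ?_⟩
      apply Additive.toMul.injective
      simpa using hb
  letI : DivisibleBy (Additive Fˣ) ℤ := divisibleByOfSMulRightSurj _ _ hroot
  obtain ⟨h, hh⟩ := (Module.Baer.of_divisible (Additive Fˣ)).extension_property_addMonoidHom
    (MonoidHom.toAdditive f) hf (AddMonoidHom.id _)
  refine ⟨MonoidHom.toAdditive.symm h, fun a => ?_⟩
  exact congrArg Additive.toMul (DFunLike.congr_fun hh (Additive.ofMul a))

theorem gradedSubfield_aux {F : Type*} [Field F] [IsAlgClosed F] {G : Type*} [AddCommGroup G]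
    {A : Type*} [Ring A] [Algebra F A] [Nontrivial A] {𝒟 : G → Submodule F A}
    (h0 : ∀ x ∈ 𝒟 0, ∃ a : F, x = a • (1 : A)) (𝒦 : GradedSubfield 𝒟) :
    (∃ K : AddSubgroup G, (K : Set G) = 𝒦.support) ∧
    (∀ g : G, 𝒦.comp g ≠ ⊥ → ∃ x : A, x ≠ 0 ∧ 𝒦.comp g = Submodule.span F {x}) ∧
    𝒦.IsGroupAlgebraOfSupport := by
  have hmem : ∀ k, k ∈ 𝒦.support ↔ ∃ u : Aˣ, (u : A) ∈ 𝒦.comp k := by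
    intro k
    constructor
    · intro hk
      obtain ⟨x, hx, hx0⟩ := (Submodule.ne_bot_iff _).1 hk
      obtain ⟨b, _, h1, h2⟩ := 𝒦.inv_mem hx hx0
      exact ⟨⟨x, b, h1, h2⟩, hx⟩
    · rintro ⟨u, hu⟩
      exact (Submodule.ne_bot_iff _).2 ⟨u, hu, u.ne_zero⟩
  have hinv : ∀ {k : G} {u : Aˣ}, (u : A) ∈ 𝒦.comp k → ((u⁻¹ : Aˣ) : A) ∈ 𝒦.comp (-k) := by
    intro k u hu
    obtain ⟨b, hb, h1, h2⟩ := 𝒦.inv_mem hu u.ne_zero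
    rwa [Units.inv_eq_of_mul_eq_one_right h1]
  have hline : ∀ {k : G} {u : Aˣ} {y : A}, (u : A) ∈ 𝒦.comp k → y ∈ 𝒦.comp k →
      ∃ a : F, y = a • (u : A) := by
    intro k u y hu hy
    have h1 := 𝒦.mul_mem hy (hinv hu)
    rw [add_neg_cancel] at h1
    obtain ⟨a, ha⟩ := h0 _ (𝒦.le 0 h1)
    refine ⟨a, ?_⟩
    have h2 := congrArg (· * (u : A)) ha
    simpa [mul_assoc] using h2
  have hspan : ∀ {k : G} {u : Aˣ}, (u : A) ∈ 𝒦.comp k →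
      𝒦.comp k = Submodule.span F {(u : A)} := by
    intro k u hu
    apply le_antisymm
    · intro y hy
      obtain ⟨a, ha⟩ := hline hu hy
      exact Submodule.mem_span_singleton.2 ⟨a, ha.symm⟩
    · rw [Submodule.span_singleton_le_iff_mem]
      exact hu
  refine ⟨⟨{ carrier := 𝒦.support, add_mem' := ?_, zero_mem' := ?_, neg_mem' := ?_ }, rfl⟩, ?_, ?_⟩
  · intro a b ha hb
    obtain ⟨u, hu⟩ := (hmem a).1 ha
    obtain ⟨v, hv⟩ := (hmem b).1 hb
    exact (hmem _).2 ⟨u * v, by simpa using 𝒦.mul_mem hu hv⟩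
  · exact (hmem 0).2 ⟨1, by simpa using 𝒦.one_mem⟩
  · intro a ha
    obtain ⟨u, hu⟩ := (hmem a).1 ha
    exact (hmem _).2 ⟨u⁻¹, hinv hu⟩
  · intro g hg
    obtain ⟨u, hu⟩ := (hmem g).1 hg
    exact ⟨u, u.ne_zero, hspan hu⟩
  let P : Subgroup Aˣ :=
    { carrier := {u | ∃ k, (u : A) ∈ 𝒦.comp k}
      mul_mem' := by
        rintro u v ⟨k, hu⟩ ⟨l, hv⟩
        exact ⟨k + l, by simpa using 𝒦.mul_mem hu hv⟩
      one_mem' := ⟨0, by simpa using 𝒦.one_mem⟩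
      inv_mem' := by
        rintro u ⟨k, hu⟩
        exact ⟨-k, hinv hu⟩ }
  letI : CommGroup P :=
    { (inferInstance : Group P) with
      mul_comm := by
        rintro ⟨u, k, hu⟩ ⟨v, l, hv⟩
        exact Subtype.ext (Units.ext (𝒦.comm hu hv)) }
  let f : Fˣ →* P := (Units.map (algebraMap F A : F →* A)).codRestrict P (by
    intro a
    refine ⟨0, ?_⟩
    have h := (𝒦.comp 0).smul_mem (a : F) 𝒦.one_mem
    simpa [Algebra.algebraMap_eq_smul_one] using h)
  have hfval : ∀ a : Fˣ, (((f a : P) : Aˣ) : A) = (a : F) • (1 : A) := fun a =>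
    Algebra.algebraMap_eq_smul_one _
  have hf : Function.Injective f := by
    intro a b hab
    have h1 : (algebraMap F A (a : F)) = algebraMap F A (b : F) :=
      congrArg (fun p : P => ((p : Aˣ) : A)) hab
    exact Units.ext ((algebraMap F A).injective h1)
  obtain ⟨r, hr⟩ := exists_retraction_units f hf
  -- normalised elements
  let n : P → P := fun p => p * f (r p)⁻¹
  have hnmul : ∀ p q, n (p * q) = n p * n q := by
    intro p q
    simp only [n, map_mul, mul_inv, map_inv]
    exact mul_mul_mul_comm _ _ _ _
  have hnf : ∀ a, n (f a) = 1 := by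
    intro a
    simp only [n, hr, map_inv, mul_inv_cancel]
  have hnmem : ∀ {k : G} {p : P}, ((p : Aˣ) : A) ∈ 𝒦.comp k →
      (((n p : P) : Aˣ) : A) ∈ 𝒦.comp k := by
    intro k p hp
    have h1 : (((n p : P) : Aˣ) : A) = ((p : Aˣ) : A) * (((f (r p)⁻¹ : P) : Aˣ) : A) := rfl
    rw [h1, hfval, mul_smul_comm, mul_one]
    exact (𝒦.comp k).smul_mem _ hp
  have hnuniq : ∀ {k : G} {p q : P}, ((p : Aˣ) : A) ∈ 𝒦.comp k → ((q : Aˣ) : A) ∈ 𝒦.comp k →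
      n p = n q := by
    intro k p q hp hq
    obtain ⟨a, ha⟩ := hline (u := (q : Aˣ)) hq hp
    have ha0 : a ≠ 0 := by
      rintro rfl
      rw [zero_smul] at ha
      exact (p : Aˣ).ne_zero ha
    have h1 : p = f (Units.mk0 a ha0) * q := by
      apply Subtype.ext
      apply Units.ext
      have h2 : (((f (Units.mk0 a ha0) * q : P) : Aˣ) : A)
        = (((f (Units.mk0 a ha0) : P) : Aˣ) : A) * ((q : Aˣ) : A) := rfl
      rw [h2, hfval, ha, smul_mul_assoc, one_mul]
      rfl
    rw [h1, hnmul, hnf, one_mul]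
  have hex : ∀ k ∈ 𝒦.support, ∃ p : P, ((p : Aˣ) : A) ∈ 𝒦.comp k := by
    intro k hk
    obtain ⟨u, hu⟩ := (hmem k).1 hk
    exact ⟨⟨u, k, hu⟩, hu⟩
  classical
  let c : G → A := fun k => if hk : k ∈ 𝒦.support then
    (((n (hex k hk).choose : P) : Aˣ) : A) else 0
  have hc : ∀ {k : G} {p : P}, ((p : Aˣ) : A) ∈ 𝒦.comp k → c k = (((n p : P) : Aˣ) : A) := by
    intro k p hp
    have hk : k ∈ 𝒦.support := (hmem k).2 ⟨p, hp⟩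
    simp only [c, dif_pos hk]
    rw [hnuniq (hex k hk).choose_spec hp]
  refine ⟨c, ?_, ?_, ?_⟩
  · have h1 : (((1 : P) : Aˣ) : A) ∈ 𝒦.comp 0 := 𝒦.one_mem
    have h2 : n 1 = 1 := by rw [← map_one f, hnf, map_one]
    rw [hc h1, h2]
    rfl
  · intro k hk
    obtain ⟨p, hp⟩ := hex k hk
    rw [hc hp]
    exact ⟨hnmem hp, Units.ne_zero _, hspan (hnmem hp)⟩
  · intro k hk l hl
    obtain ⟨p, hp⟩ := hex k hk
    obtain ⟨q, hq⟩ := hex l hl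
    have hpq : (((p * q : P) : Aˣ) : A) ∈ 𝒦.comp (k + l) := 𝒦.mul_mem hp hq
    rw [hc hp, hc hq, hc hpq, hnmul]
    rfl


/-- Assume `F` algebraically closed.  Let `W` be a `G`-graded
simple left `R`-module that is graded central.  Then for any graded subfield
`𝒦` of `C(W)`: the support of `𝒦` is a subgroup of `G`, each nonzero
homogeneous component of `𝒦` is one-dimensional, and `𝒦` is isomorphic to the
group algebra of its support as a `G`-graded algebra (i.e. it has a
multiplicative homogeneous basis). -/
theorem statement4 {F : Type*} [Field F] [IsAlgClosed F] {G : Type*} [AddCommGroup G]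
    {R : Type*} [Ring R] [Algebra F R]
    {W : Type*} [AddCommGroup W] [Module F W] [Module R W] [IsScalarTower F R W]
    [SMulCommClass R F W]
    (𝒜 : AlgebraGrading F G R) (𝒲 : ModuleGrading 𝒜 (AddMonoidHom.id G) W)
    (hsimple : IsGradedSimpleModule R 𝒲.comp)
    (hcentral : ∀ f : Module.End R W, IsHomogeneousEnd 𝒲.comp (0 : G) f →
      ∃ a : F, ∀ x : W, f x = a • x)
    (𝒦 : GradedSubfield (homogComp 𝒲.comp)) :
    (∃ K : AddSubgroup G, (K : Set G) = 𝒦.support) ∧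
    (∀ g : G, 𝒦.comp g ≠ ⊥ →
      ∃ x : Module.End R W, x ≠ 0 ∧ 𝒦.comp g = Submodule.span F {x}) ∧
    𝒦.IsGroupAlgebraOfSupport := by
  obtain ⟨v, hv⟩ := hsimple.1
  haveI : Nontrivial W := ⟨⟨v, 0, hv⟩⟩
  refine gradedSubfield_aux ?_ 𝒦
  intro x hx
  obtain ⟨a, ha⟩ := hcentral x hx
  exact ⟨a, LinearMap.ext ha⟩

end GradedPaper
end
end

section
/- Let K ≤ H ≤ G be subgroups and let π: G → G/H, π′: G → G/K and π″: G/K → G/H be the natural homomorphisms. Then for any G/H-graded left R-module V, the G-graded left R-modules L_π(V) and L_{π′}(L_{π″}(V)) are isomorphic; an isomorphism is given by v_{gH} ⊗ g ↦ (v_{gH} ⊗ gK) ⊗ g. -/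
/-! Common definitions: gradings on algebras and modules, graded simplicity,
homogeneous endomorphisms, graded subfields, and loop modules. -/

noncomputable section

namespace GradedPaper

universe u₁ u₂ u₃ u₄

/-- The coefficientwise map `v ⊗ g ↦ v ⊗ gK` in degree `g`. -/
def liftCoeff {F : Type*} [Field F] {V Q₁ Q₂ : Type*} [AddCommGroup V] [Module F V]
    (s : Q₁ → Q₂) (ℳ : Q₂ → Submodule F V) (b : Q₁) (v : V) (hv : v ∈ ℳ (s b)) :
    ↥(LoopSubmodule s ℳ) :=
  ⟨Finsupp.single b v, by
    classical
    intro a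
    rw [Finsupp.single_apply]
    split_ifs with h
    · exact h ▸ hv
    · exact (ℳ _).zero_mem⟩

lemma homog_ind {F : Type*} [Field F] {G : Type*} [AddCommGroup G]
    {R : Type*} [Ring R] [Algebra F R] (𝒜 : AlgebraGrading F G R)
    {M N : Type*} [AddCommGroup M] [AddCommGroup N] [Module R M] [Module R N]
    (e : M ≃+ N) (h : ∀ g : G, ∀ r ∈ 𝒜.comp g, ∀ x, e (r • x) = r • e x)
    (r : R) (x : M) : e (r • x) = r • e x := by
  obtain ⟨t, c, hc, rfl⟩ := 𝒜.decomp.1 r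
  rw [Finset.sum_smul, Finset.sum_smul, map_sum]
  exact Finset.sum_congr rfl fun i hi => h i _ (hc i hi) x

/-- transitivity of the loop construction.  For `K ≤ H ≤ G`
and a `G/H`-graded module `V`, the `G`-graded modules `L_π(V)` and
`L_{π'}(L_{π''}(V))` are isomorphic, an isomorphism being given by
`v_{gH} ⊗ g ↦ (v_{gH} ⊗ gK) ⊗ g`. -/
theorem statement5 {F : Type*} [Field F] {G : Type*} [AddCommGroup G]
    {R : Type*} [Ring R] [Algebra F R] (K H : AddSubgroup G) (hKH : K ≤ H)
    (π'' : (G ⧸ K) →+ (G ⧸ H))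
    (hπ'' : ∀ g : G, π'' ((QuotientAddGroup.mk' K) g) = (QuotientAddGroup.mk' H) g)
    {V : Type*} [AddCommGroup V] [Module F V] [Module R V] [IsScalarTower F R V]
    (𝒜 : AlgebraGrading F G R)
    (𝒱 : ModuleGrading 𝒜 (QuotientAddGroup.mk' H) V)
    -- the loop module `L_π(V)`
    (i₁ : Module R ↥(LoopSubmodule (⇑(QuotientAddGroup.mk' H)) 𝒱.comp))
    (h₁ : IsLoopSMul 𝒜 (AddMonoidHom.id G) (⇑(QuotientAddGroup.mk' H)) 𝒱.comp i₁)
    -- the loop module `L_{π''}(V)`, a `G/K`-graded `R`-module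
    (i₂ : Module R ↥(LoopSubmodule (⇑π'') 𝒱.comp))
    (h₂ : IsLoopSMul 𝒜 (QuotientAddGroup.mk' K) (⇑π'') 𝒱.comp i₂)
    (htow₂ : IsScalarTower F R ↥(LoopSubmodule (⇑π'') 𝒱.comp))
    (𝒱₂ : ModuleGrading 𝒜 (QuotientAddGroup.mk' K) ↥(LoopSubmodule (⇑π'') 𝒱.comp))
    (h𝒱₂ : 𝒱₂.comp = loopComp (⇑π'') 𝒱.comp)
    -- the loop module `L_{π'}(L_{π''}(V))`
    (i₃ : Module R ↥(LoopSubmodule (⇑(QuotientAddGroup.mk' K)) 𝒱₂.comp))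
    (h₃ : IsLoopSMul 𝒜 (AddMonoidHom.id G) (⇑(QuotientAddGroup.mk' K)) 𝒱₂.comp i₃) :
    ∃ e : ↥(LoopSubmodule (⇑(QuotientAddGroup.mk' H)) 𝒱.comp) ≃ₗ[R]
        ↥(LoopSubmodule (⇑(QuotientAddGroup.mk' K)) 𝒱₂.comp),
      (∀ g : G, ∀ x ∈ loopComp (⇑(QuotientAddGroup.mk' H)) 𝒱.comp g,
        e x ∈ loopComp (⇑(QuotientAddGroup.mk' K)) 𝒱₂.comp g) ∧
      (∀ g : G, ∀ y ∈ loopComp (⇑(QuotientAddGroup.mk' K)) 𝒱₂.comp g,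
        e.symm y ∈ loopComp (⇑(QuotientAddGroup.mk' H)) 𝒱.comp g) ∧
      ∀ (x : ↥(LoopSubmodule (⇑(QuotientAddGroup.mk' H)) 𝒱.comp)) (g : G),
        ((↑((↑(e x) : G →₀ ↥(LoopSubmodule (⇑π'') 𝒱.comp)) g) : (G ⧸ K) →₀ V)
            ((QuotientAddGroup.mk' K) g) = (↑x : G →₀ V) g) ∧
        (∀ b : G ⧸ K, b ≠ (QuotientAddGroup.mk' K) g →
          (↑((↑(e x) : G →₀ ↥(LoopSubmodule (⇑π'') 𝒱.comp)) g) : (G ⧸ K) →₀ V) b = 0) := by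
  classical
  have hm : ∀ (x : ↥(LoopSubmodule (⇑(QuotientAddGroup.mk' H)) 𝒱.comp)) (g : G),
      (x : G →₀ V) g ∈ 𝒱.comp (π'' ((QuotientAddGroup.mk' K) g)) := by
    intro x g
    rw [hπ'']
    exact x.2 g
  let fwd : ↥(LoopSubmodule (⇑(QuotientAddGroup.mk' H)) 𝒱.comp) →
      ↥(LoopSubmodule (⇑(QuotientAddGroup.mk' K)) 𝒱₂.comp) := fun x =>
    ⟨Finsupp.onFinset (x : G →₀ V).support
      (fun g => liftCoeff (⇑π'') 𝒱.comp ((QuotientAddGroup.mk' K) g) ((x : G →₀ V) g) (hm x g))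
      (by
        intro g hg
        rw [Finsupp.mem_support_iff]
        intro h0
        apply hg
        apply Subtype.ext
        change Finsupp.single _ ((x : G →₀ V) g) = 0
        rw [h0, Finsupp.single_zero]), by
      intro g
      rw [h𝒱₂]
      intro b hb
      exact Finsupp.single_eq_of_ne hb⟩
  have hto : ∀ x g, (((fwd x : G →₀ ↥(LoopSubmodule (⇑π'') 𝒱.comp)) g :
      ↥(LoopSubmodule (⇑π'') 𝒱.comp)) : (G ⧸ K) →₀ V)
      = Finsupp.single ((QuotientAddGroup.mk' K) g) ((x : G →₀ V) g) := fun x g => rfl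
  let inv : ↥(LoopSubmodule (⇑(QuotientAddGroup.mk' K)) 𝒱₂.comp) →
      ↥(LoopSubmodule (⇑(QuotientAddGroup.mk' H)) 𝒱.comp) := fun y =>
    ⟨Finsupp.onFinset (y : G →₀ ↥(LoopSubmodule (⇑π'') 𝒱.comp)).support
      (fun g => (((y : G →₀ ↥(LoopSubmodule (⇑π'') 𝒱.comp)) g :
        ↥(LoopSubmodule (⇑π'') 𝒱.comp)) : (G ⧸ K) →₀ V) ((QuotientAddGroup.mk' K) g))
      (by
        intro g hg
        rw [Finsupp.mem_support_iff]
        intro h0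
        apply hg
        rw [h0]
        rfl), by
      intro g
      rw [← hπ'']
      exact ((y : G →₀ ↥(LoopSubmodule (⇑π'') 𝒱.comp)) g).2 _⟩
  have hinv : ∀ y g, ((inv y : G →₀ V) g) =
      (((y : G →₀ ↥(LoopSubmodule (⇑π'') 𝒱.comp)) g :
        ↥(LoopSubmodule (⇑π'') 𝒱.comp)) : (G ⧸ K) →₀ V) ((QuotientAddGroup.mk' K) g) :=
    fun y g => rfl
  have hy0 : ∀ (y : ↥(LoopSubmodule (⇑(QuotientAddGroup.mk' K)) 𝒱₂.comp)) (g : G) (b : G ⧸ K),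
      b ≠ (QuotientAddGroup.mk' K) g →
      (((y : G →₀ ↥(LoopSubmodule (⇑π'') 𝒱.comp)) g :
        ↥(LoopSubmodule (⇑π'') 𝒱.comp)) : (G ⧸ K) →₀ V) b = 0 := by
    intro y g b hb
    have h := (congrFun h𝒱₂ ((QuotientAddGroup.mk' K) g)).le (y.2 g)
    exact h b hb
  let e₀ : ↥(LoopSubmodule (⇑(QuotientAddGroup.mk' H)) 𝒱.comp) ≃+
      ↥(LoopSubmodule (⇑(QuotientAddGroup.mk' K)) 𝒱₂.comp) :=
    { toFun := fwd
      invFun := inv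
      left_inv := by
        intro x
        apply Subtype.ext
        ext g
        rw [hinv, hto, Finsupp.single_eq_same]
      right_inv := by
        intro y
        apply Subtype.ext
        apply Finsupp.ext
        intro g
        apply Subtype.ext
        rw [hto, hinv]
        ext b
        by_cases hb : b = (QuotientAddGroup.mk' K) g
        · rw [hb, Finsupp.single_eq_same]
        · rw [Finsupp.single_eq_of_ne hb, hy0 y g b hb]
      map_add' := by
        intro x y
        apply Subtype.ext
        apply Finsupp.ext
        intro g
        apply Subtype.ext
        exact Finsupp.single_add _ _ _ }
  have hlin : ∀ g : G, ∀ r ∈ 𝒜.comp g, ∀ x, e₀ (r • x) = r • e₀ x := by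
    intro g r hr x
    apply Subtype.ext
    apply Finsupp.ext
    intro a
    have e3 := h₃ hr (fwd x) a
    have e1 := h₁ hr x a
    refine Eq.trans ?_ e3.symm
    apply Subtype.ext
    ext b
    have e2 := h₂ hr ((fwd x : G →₀ ↥(LoopSubmodule (⇑π'') 𝒱.comp)) (a - g)) b
    refine Eq.trans ?_ e2.symm
    change (Finsupp.single ((QuotientAddGroup.mk' K) a)
      (((msmul i₁ r x : ↥(LoopSubmodule (⇑(QuotientAddGroup.mk' H)) 𝒱.comp)) : G →₀ V) a)) b = _
    rw [e1, hto, map_sub (QuotientAddGroup.mk' K)]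
    by_cases hb : b = (QuotientAddGroup.mk' K) a
    · rw [hb, Finsupp.single_eq_same, Finsupp.single_eq_same]
      rfl
    · rw [Finsupp.single_eq_of_ne hb, Finsupp.single_eq_of_ne, smul_zero]
      intro h
      exact hb (sub_left_injective h)
  refine ⟨{ e₀ with map_smul' := fun r x => homog_ind 𝒜 e₀ hlin r x }, ?_, ?_, ?_⟩
  · intro g x hx b hb
    apply Subtype.ext
    change Finsupp.single _ ((x : G →₀ V) b) = 0
    rw [hx b hb, Finsupp.single_zero]
  · intro g y hy b hb
    change (inv y : G →₀ V) b = 0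
    rw [hinv, hy b hb]
    rfl
  · intro x g
    exact ⟨Finsupp.single_eq_same, fun b hb => Finsupp.single_eq_of_ne hb⟩

end GradedPaper
end
end

section
/- Assume H is finite of order n, F is algebraically closed, and char F does not divide n. Let Ĝ = Hom(G, F^×), H^⊥ = {χ ∈ Ĝ : χ(h) = 1 for all h ∈ H}, and let {χ_1, …, χ_n} ⊆ Ĝ be a transversal of H^⊥ in Ĝ. Let V be a Ḡ-graded left R-module, regarded as an F(H^⊥)-module via χ·v_ḡ = χ(g)·v_ḡ, and let I_π(V) = FĜ ⊗_{F(H^⊥)} V = ⊕_{j=1}^n χ_j ⊗ V, a left R-module via r_{g'}·(χ_j ⊗ v_ḡ) = χ_j(g′)^{-1}·(χ_j ⊗ r_{g'}·v_ḡ), with G-grading I_π(V)_g = {x ∈ χ_1 ⊗ V_ḡ ⊕ ⋯ ⊕ χ_n ⊗ V_ḡ : χ·x = χ(g)·x for all χ ∈ Ĝ}. Then: the linear map φ: L_π(V) → I_π(V), v_ḡ ⊗ g ↦ Σ_{j=1}^n χ_j(g)^{-1}·χ_j ⊗ v_ḡ, does not depend on the choice of transversal; φ is an isomorphism of G-graded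 left R-modules, with inverse ψ given by χ_j ⊗ v_ḡ ↦ (1/n)·Σ_{h∈H} χ_j(gh)·v_ḡ ⊗ gh. -/
/-! Common definitions: gradings on algebras and modules, graded simplicity,
homogeneous endomorphisms, graded subfields, and loop modules. -/

noncomputable section

namespace GradedPaper

/-- Row orthogonality for a character of `G` restricted to `H`. -/
lemma sum_char_eq_zero {F : Type*} [Field F] {G : Type*} [AddCommGroup G] (H : AddSubgroup G)
    [Fintype ↥H] (χ : AddChar G Fˣ) (k : ↥H) (hk : χ (k : G) ≠ 1) :
    ∑ h : ↥H, ((χ (h : G) : Fˣ) : F) = 0 := by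
  have h1 : ((χ (k : G) : Fˣ) : F) * ∑ h : ↥H, ((χ (h : G) : Fˣ) : F)
      = ∑ h : ↥H, ((χ (h : G) : Fˣ) : F) := by
    rw [Finset.mul_sum]
    refine Fintype.sum_equiv (Equiv.addLeft k) _ _ fun h => ?_
    simp [AddChar.map_add_eq_mul]
  have h2 : (((χ (k : G) : Fˣ) : F) - 1) * ∑ h : ↥H, ((χ (h : G) : Fˣ) : F) = 0 := by
    rw [sub_mul, h1, one_mul, sub_self]
  rcases mul_eq_zero.mp h2 with h | h
  · exact absurd (Units.ext (by simpa [sub_eq_zero] using h)) hk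
  · exact h

lemma row_orth {F : Type*} [Field F] {G : Type*} [AddCommGroup G] (H : AddSubgroup G)
    [Fintype ↥H] (n : ℕ) (hn : Nat.card ↥H = n) (hnF : (n : F) ≠ 0)
    (χs : Fin n → AddChar G Fˣ)
    (htrans : ∀ χ : AddChar G Fˣ, ∃! j : Fin n, ∀ h : ↥H, χ (h : G) = χs j (h : G))
    (i j : Fin n) :
    (n : F)⁻¹ * ∑ h : ↥H, ((χs j (h : G) : Fˣ) : F) * (((χs i (h : G))⁻¹ : Fˣ) : F)
      = if i = j then 1 else 0 := by
  split_ifs with hij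
  · subst hij
    simp only [Units.mul_inv]
    rw [Finset.sum_const, Finset.card_univ, ← Nat.card_eq_fintype_card, hn]
    simp [hnF]
  · have : ∃ k : ↥H, (χs j * (χs i)⁻¹) (k : G) ≠ 1 := by
      by_contra! hcon
      apply hij
      refine (htrans (χs j)).unique (fun h => ?_) (fun h => rfl)
      have := hcon h
      rw [AddChar.mul_apply, AddChar.inv_apply'] at this
      exact mul_inv_eq_one.mp this
    obtain ⟨k, hk⟩ := this
    have := sum_char_eq_zero H _ k hk
    simp only [AddChar.mul_apply, AddChar.inv_apply', Units.val_mul] at this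
    rw [this, mul_zero]

lemma col_orth {F : Type*} [Field F] {G : Type*} [AddCommGroup G] (H : AddSubgroup G)
    [Fintype ↥H] [DecidableEq ↥H] (n : ℕ) (hn : Nat.card ↥H = n) (hnF : (n : F) ≠ 0)
    (χs : Fin n → AddChar G Fˣ)
    (htrans : ∀ χ : AddChar G Fˣ, ∃! j : Fin n, ∀ h : ↥H, χ (h : G) = χs j (h : G))
    (h k : ↥H) :
    ∑ j, ((χs j (h : G) : Fˣ) : F) * (((χs j (k : G))⁻¹ : Fˣ) : F)
      = if h = k then (n : F) else 0 := by
  let A : Matrix (Fin n) ↥H F := fun i h => (((χs i (h : G))⁻¹ : Fˣ) : F)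
  let B : Matrix ↥H (Fin n) F := fun h j => (n : F)⁻¹ * ((χs j (h : G) : Fˣ) : F)
  have hAB : A * B = 1 := by
    ext i j
    rw [Matrix.mul_apply, Matrix.one_apply, ← row_orth H n hn hnF χs htrans i j, Finset.mul_sum]
    refine Finset.sum_congr rfl fun h _ => ?_
    simp only [A, B]; ring
  have hcard : Fintype.card (Fin n) = Fintype.card ↥H := by
    rw [Fintype.card_fin, ← Nat.card_eq_fintype_card, hn]
  have hBA : B * A = 1 := (Matrix.mul_eq_one_comm_of_card_eq (Fin n) ↥H F hcard).mp hAB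
  have := congrFun (congrFun hBA h) k
  rw [Matrix.mul_apply, Matrix.one_apply] at this
  have h2 : (n : F)⁻¹ * ∑ j, ((χs j (h : G) : Fˣ) : F) * (((χs j (k : G))⁻¹ : Fˣ) : F)
      = if h = k then 1 else 0 := by
    rw [← this, Finset.mul_sum]
    refine Finset.sum_congr rfl fun j _ => ?_
    simp only [A, B]; ring
  have h3 := congrArg (fun x => (n : F) * x) h2
  simp only [mul_inv_cancel_left₀ hnF] at h3
  rw [h3]; split_ifs <;> simp

/-- Independence of the transversal. -/
lemma indep {F : Type*} [Field F] {G : Type*} [AddCommGroup G] (H : AddSubgroup G) (n : ℕ)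
    {V : Type*} [AddCommGroup V] [Module F V] (ℳ : G ⧸ H → Submodule F V)
    {I : Type*} [AddCommGroup I] [Module F I]
    (ι : AddChar G Fˣ → (V →ₗ[F] I))
    (hι1 : ∀ (χ ϖ : AddChar G Fˣ), (∀ h : ↥H, ϖ (h : G) = 1) →
      ∀ (g : G), ∀ v ∈ ℳ ((QuotientAddGroup.mk' H) g),
        ι (χ * ϖ) v = ((ϖ g : Fˣ) : F) • ι χ v)
    (χs : Fin n → AddChar G Fˣ)
    (htrans : ∀ χ : AddChar G Fˣ, ∃! j : Fin n, ∀ h : ↥H, χ (h : G) = χs j (h : G))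
    (χs' : Fin n → AddChar G Fˣ)
    (htrans' : ∀ χ : AddChar G Fˣ, ∃! j : Fin n, ∀ h : ↥H, χ (h : G) = χs' j (h : G))
    (g : G) (v : V) (hv : v ∈ ℳ ((QuotientAddGroup.mk' H) g)) :
    ∑ j, (((χs' j g)⁻¹ : Fˣ) : F) • ι (χs' j) v
          = ∑ j, (((χs j g)⁻¹ : Fˣ) : F) • ι (χs j) v := by
  choose σ hσ _ using fun j => htrans (χs' j)
  have hinj : Function.Injective σ := by
    intro a b hab
    refine (htrans' (χs' a)).unique (fun h => rfl) (fun h => ?_)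
    rw [hσ a h, hσ b h, hab]
  have hbij := Finite.injective_iff_bijective.mp hinj
  refine Fintype.sum_bijective σ hbij _ _ fun j => ?_
  have h1 : χs' j = χs (σ j) * (χs' j * (χs (σ j))⁻¹) := by
    rw [mul_comm (χs' j), mul_inv_cancel_left]
  have h2 := hι1 (χs (σ j)) (χs' j * (χs (σ j))⁻¹) (fun h => by
    rw [AddChar.mul_apply, AddChar.inv_apply']; exact mul_inv_eq_one.mpr (hσ j h)) g v hv
  rw [← h1] at h2
  rw [h2, smul_smul, ← Units.val_mul, AddChar.mul_apply, AddChar.inv_apply', inv_mul_cancel_left]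

/-- The linear map underlying `φ`, on all finitely supported functions. -/
def bigPhi {F : Type*} [Field F] {G : Type*} [AddCommGroup G] {n : ℕ}
    {V : Type*} [AddCommGroup V] [Module F V]
    {I : Type*} [AddCommGroup I] [Module F I]
    (ι : AddChar G Fˣ → (V →ₗ[F] I)) (χs : Fin n → AddChar G Fˣ) : (G →₀ V) →ₗ[F] I :=
  Finsupp.lsum F fun g => ∑ j, (((χs j g)⁻¹ : Fˣ) : F) • ι (χs j)

lemma bigPhi_single {F : Type*} [Field F] {G : Type*} [AddCommGroup G] {n : ℕ}
    {V : Type*} [AddCommGroup V] [Module F V]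
    {I : Type*} [AddCommGroup I] [Module F I]
    (ι : AddChar G Fˣ → (V →ₗ[F] I)) (χs : Fin n → AddChar G Fˣ) (g : G) (v : V) :
    bigPhi ι χs (Finsupp.single g v) = ∑ j, (((χs j g)⁻¹ : Fˣ) : F) • ι (χs j) v := by
  simp [bigPhi, LinearMap.sum_apply]

/-- The element `ψ(χ ⊗ v)`. -/
def psiElt {F : Type*} [Field F] {G : Type*} [AddCommGroup G] (H : AddSubgroup G) [Fintype ↥H]
    (n : ℕ) {V : Type*} [AddCommGroup V] [Module F V] (χ : AddChar G Fˣ) (g : G) (v : V) :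
    G →₀ V :=
  ∑ h : ↥H, Finsupp.single (g + (h : G)) ((n : F)⁻¹ • (((χ (g + (h : G)) : Fˣ) : F) • v))

lemma psiElt_apply_mem {F : Type*} [Field F] {G : Type*} [AddCommGroup G] (H : AddSubgroup G)
    [Fintype ↥H] (n : ℕ) {V : Type*} [AddCommGroup V] [Module F V] (χ : AddChar G Fˣ) (g : G)
    (v : V) (a : G) (ha : a - g ∈ H) :
    psiElt H n χ g v a = (n : F)⁻¹ • (((χ a : Fˣ) : F) • v) := by
  classical
  rw [psiElt, Finsupp.finsetSum_apply, Finset.sum_eq_single (⟨a - g, ha⟩ : ↥H)]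
  · simp
  · intro b _ hb
    rw [Finsupp.single_apply, if_neg]
    intro h
    exact hb (Subtype.ext (by simp [← h]))
  · simp

lemma psiElt_apply_notMem {F : Type*} [Field F] {G : Type*} [AddCommGroup G] (H : AddSubgroup G)
    [Fintype ↥H] (n : ℕ) {V : Type*} [AddCommGroup V] [Module F V] (χ : AddChar G Fˣ) (g : G)
    (v : V) (a : G) (ha : a - g ∉ H) :
    psiElt H n χ g v a = 0 := by
  classical
  rw [psiElt, Finsupp.finsetSum_apply]
  refine Finset.sum_eq_zero fun b _ => ?_
  rw [Finsupp.single_apply, if_neg]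
  intro h
  exact ha (by simp [← h])

lemma psiElt_mem {F : Type*} [Field F] {G : Type*} [AddCommGroup G] (H : AddSubgroup G)
    [Fintype ↥H] (n : ℕ) {V : Type*} [AddCommGroup V] [Module F V]
    (ℳ : G ⧸ H → Submodule F V) (χ : AddChar G Fˣ) (g : G)
    (v : V) (hv : v ∈ ℳ ((QuotientAddGroup.mk' H) g)) :
    psiElt H n χ g v ∈ LoopSubmodule (⇑(QuotientAddGroup.mk' H)) ℳ := by
  intro a
  by_cases ha : a - g ∈ H
  · rw [psiElt_apply_mem H n χ g v a ha]
    have : (QuotientAddGroup.mk' H) a = (QuotientAddGroup.mk' H) g := by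
      rw [← sub_eq_zero, ← map_sub]
      exact (QuotientAddGroup.eq_zero_iff _).mpr ha
    rw [this]
    exact Submodule.smul_mem _ _ (Submodule.smul_mem _ _ hv)
  · rw [psiElt_apply_notMem H n χ g v a ha]
    exact Submodule.zero_mem _

lemma bigPhi_psiElt {F : Type*} [Field F] {G : Type*} [AddCommGroup G] (H : AddSubgroup G)
    [Fintype ↥H] (n : ℕ) (hn : Nat.card ↥H = n) (hnF : (n : F) ≠ 0)
    {V : Type*} [AddCommGroup V] [Module F V]
    {I : Type*} [AddCommGroup I] [Module F I]
    (ι : AddChar G Fˣ → (V →ₗ[F] I)) (χs : Fin n → AddChar G Fˣ)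
    (htrans : ∀ χ : AddChar G Fˣ, ∃! j : Fin n, ∀ h : ↥H, χ (h : G) = χs j (h : G))
    (j : Fin n) (g : G) (v : V) :
    bigPhi ι χs (psiElt H n (χs j) g v) = ι (χs j) v := by
  rw [psiElt, map_sum]
  simp only [bigPhi_single, map_smul, smul_smul]
  rw [Finset.sum_comm]
  simp only [← Finset.sum_smul]
  have key : ∀ i, ∑ h : ↥H, (((χs i (g + (h : G)))⁻¹ : Fˣ) : F) *
      ((n : F)⁻¹ * ((χs j (g + (h : G)) : Fˣ) : F)) = if i = j then 1 else 0 := by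
    intro i
    have h1 := row_orth H n hn hnF χs htrans i j
    have h2 : ∑ h : ↥H, (((χs i (g + (h : G)))⁻¹ : Fˣ) : F) *
      ((n : F)⁻¹ * ((χs j (g + (h : G)) : Fˣ) : F)) =
      ((((χs i g)⁻¹ : Fˣ) : F) * ((χs j g : Fˣ) : F)) * ((n : F)⁻¹ *
        ∑ h : ↥H, ((χs j (h : G) : Fˣ) : F) * (((χs i (h : G))⁻¹ : Fˣ) : F)) := by
      rw [Finset.mul_sum, Finset.mul_sum]
      refine Finset.sum_congr rfl fun h _ => ?_
      simp only [AddChar.map_add_eq_mul, mul_inv, Units.val_mul]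
      ring
    rw [h2, h1]
    split_ifs with hij
    · subst hij; simp
    · simp
  simp only [key]
  simp

lemma bigPhi_eq {F : Type*} [Field F] {G : Type*} [AddCommGroup G] {n : ℕ}
    {V : Type*} [AddCommGroup V] [Module F V]
    {I : Type*} [AddCommGroup I] [Module F I]
    (ι : AddChar G Fˣ → (V →ₗ[F] I)) (χs : Fin n → AddChar G Fˣ) (f : G →₀ V) :
    bigPhi ι χs f
      = ∑ j, ι (χs j) (∑ g ∈ f.support, (((χs j g)⁻¹ : Fˣ) : F) • f g) := by
  simp only [map_sum, map_smul]
  rw [Finset.sum_comm]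
  conv_lhs => rw [← Finsupp.sum_single f, Finsupp.sum, map_sum]
  simp only [bigPhi_single]

lemma bigPhi_inj {F : Type*} [Field F] {G : Type*} [AddCommGroup G] (H : AddSubgroup G)
    [Fintype ↥H] (n : ℕ) (hn : Nat.card ↥H = n) (hnF : (n : F) ≠ 0)
    {V : Type*} [AddCommGroup V] [Module F V] (ℳ : G ⧸ H → Submodule F V)
    (hℳ : IsVSDecomp ℳ)
    {I : Type*} [AddCommGroup I] [Module F I]
    (ι : AddChar G Fˣ → (V →ₗ[F] I)) (χs : Fin n → AddChar G Fˣ)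
    (htrans : ∀ χ : AddChar G Fˣ, ∃! j : Fin n, ∀ h : ↥H, χ (h : G) = χs j (h : G))
    (hι4 : ∀ vv : Fin n → V, ∑ j, ι (χs j) (vv j) = 0 → ∀ j, vv j = 0)
    (f : G →₀ V) (hf : f ∈ LoopSubmodule (⇑(QuotientAddGroup.mk' H)) ℳ)
    (h0 : bigPhi ι χs f = 0) : f = 0 := by
  classical
  rw [bigPhi_eq] at h0
  have h1 := hι4 _ h0
  -- coset sums vanish
  have h2 : ∀ (j : Fin n) (q : G ⧸ H),
      ∑ g ∈ f.support with (QuotientAddGroup.mk' H) g = q,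
        (((χs j g)⁻¹ : Fˣ) : F) • f g = 0 := by
    intro j q
    have h3 := hℳ.2 (insert q (f.support.image (QuotientAddGroup.mk' H)))
      (fun q => ∑ g ∈ f.support with (QuotientAddGroup.mk' H) g = q,
        (((χs j g)⁻¹ : Fˣ) : F) • f g) (fun q _ => by
          refine Submodule.sum_mem _ fun g hg => Submodule.smul_mem _ _ ?_
          have := hf g
          rwa [(Finset.mem_filter.mp hg).2] at this) (by
          rw [Finset.sum_fiberwise_of_maps_to]
          · exact h1 j
          · intro g hg
            exact Finset.mem_insert_of_mem (Finset.mem_image_of_mem _ hg))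
    exact h3 q (Finset.mem_insert_self _ _)
  have h4 : ∀ (j : Fin n) (g : G), ∑ h : ↥H, (((χs j (h : G))⁻¹ : Fˣ) : F) • f (g + (h : G)) = 0 := by
    intro j g
    have h5 : ∑ h : ↥H, (((χs j (g + (h : G)))⁻¹ : Fˣ) : F) • f (g + (h : G)) = 0 := by
      rw [← h2 j ((QuotientAddGroup.mk' H) g)]
      symm
      have hinj : Function.Injective (fun h : ↥H => g + (h : G)) :=
        fun a b hab => Subtype.ext (add_left_cancel hab)
      rw [← Finset.sum_image (s := Finset.univ) (g := fun h : ↥H => g + (h : G))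
        (f := fun a => (((χs j a)⁻¹ : Fˣ) : F) • f a) (fun a _ b _ hab => hinj hab)]
      refine Finset.sum_subset ?_ ?_
      · intro a ha
        have ha2 := (Finset.mem_filter.mp ha).2
        have ha3 : a - g ∈ H := by
          rw [← sub_eq_zero, ← map_sub] at ha2
          exact (QuotientAddGroup.eq_zero_iff _).mp ha2
        exact Finset.mem_image.mpr ⟨⟨a - g, ha3⟩, Finset.mem_univ _, by simp⟩
      · intro a ha hna
        obtain ⟨h, _, rfl⟩ := Finset.mem_image.mp ha
        have : f (g + (h : G)) = 0 := by
          by_contra hne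
          exact hna (Finset.mem_filter.mpr
            ⟨Finsupp.mem_support_iff.mpr hne, mk'_add_right_mem H h g⟩)
        rw [this, smul_zero]
    have h6 : (((χs j g)⁻¹ : Fˣ) : F) •
        ∑ h : ↥H, (((χs j (h : G))⁻¹ : Fˣ) : F) • f (g + (h : G)) = 0 := by
      rw [← h5, Finset.smul_sum]
      refine Finset.sum_congr rfl fun h _ => ?_
      simp only [AddChar.map_add_eq_mul, mul_inv, Units.val_mul, smul_smul]
    exact (smul_eq_zero.mp h6).resolve_left (Units.ne_zero _)
  ext g
  have h7 : ∑ j, ((χs j ((0 : ↥H) : G) : Fˣ) : F) •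
      ∑ h : ↥H, (((χs j (h : G))⁻¹ : Fˣ) : F) • f (g + (h : G)) = 0 :=
    Finset.sum_eq_zero fun j _ => by rw [h4 j g, smul_zero]
  simp only [Finset.smul_sum, smul_smul] at h7
  rw [Finset.sum_comm] at h7
  simp only [← Finset.sum_smul, col_orth H n hn hnF χs htrans] at h7
  simpa [hnF] using h7

/-- `φ` intertwines the actions of homogeneous elements. -/
lemma bigPhi_smul {F : Type*} [Field F] {G : Type*} [AddCommGroup G] {n : ℕ}
    {R : Type*} [Ring R] [Algebra F R]
    {V : Type*} [AddCommGroup V] [Module F V] [Module R V] [IsScalarTower F R V]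
    {I : Type*} [AddCommGroup I] [Module F I] [Module R I]
    (ι : AddChar G Fˣ → (V →ₗ[F] I)) (χs : Fin n → AddChar G Fˣ) (g' : G) (r : R)
    (hr : ∀ (χ : AddChar G Fˣ) (v : V),
      r • ι χ v = (((χ g')⁻¹ : Fˣ) : F) • ι χ (r • v))
    (f f' : G →₀ V) (hf : ∀ a, f' a = r • f (a - g')) :
    bigPhi ι χs f' = r • bigPhi ι χs f := by
  classical
  have h1 : f' = ∑ a ∈ f.support, Finsupp.single (a + g') (r • f a) := by
    ext b
    rw [hf b, Finsupp.finsetSum_apply, Finset.sum_eq_single (b - g')]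
    · simp
    · intro c _ hc
      rw [Finsupp.single_apply, if_neg]
      intro h
      exact hc (by simp [← h])
    · intro h
      simp [Finsupp.notMem_support_iff.mp h]
  rw [h1, map_sum]
  conv_rhs => rw [← Finsupp.sum_single f, Finsupp.sum, map_sum, Finset.smul_sum]
  refine Finset.sum_congr rfl fun a _ => ?_
  rw [bigPhi_single, bigPhi_single, Finset.smul_sum]
  refine Finset.sum_congr rfl fun j _ => ?_
  rw [← map_smul (ι (χs j)) _ (f a), hr, smul_comm r, (ι (χs j)).map_smul _ (r • f a), smul_smul,
    AddChar.map_add_eq_mul, mul_inv, Units.val_mul, mul_comm]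

/-- `H` finite of order `n`, `F` algebraically closed,
`char F ∤ n`.  Let `{χ_1, …, χ_n}` be a transversal of `H^⊥` in `Ĝ`, and let
`I_π(V) = FĜ ⊗_{F(H^⊥)} V = ⊕_j χ_j ⊗ V` be the induced module, presented
abstractly by the maps `ι χ : V → I`, `v ↦ χ ⊗ v` (with the relations
`χϖ ⊗ v_ḡ = ϖ(g)·(χ ⊗ v_ḡ)` for `ϖ ∈ H^⊥`, the `R`-action
`r_{g'}·(χ ⊗ v) = χ(g')⁻¹·(χ ⊗ r_{g'} v)`, and `I = ⊕_j ι_{χ_j}(V)`).  Then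
the map `φ : L_π(V) → I_π(V)`, `v_ḡ ⊗ g ↦ Σ_j χ_j(g)⁻¹·(χ_j ⊗ v_ḡ)`, does not
depend on the transversal, and is an isomorphism of `G`-graded left
`R`-modules (the grading on `I` being by simultaneous `Ĝ`-eigenspaces), with
inverse `ψ : χ_j ⊗ v_ḡ ↦ (1/n)·Σ_{h ∈ H} χ_j(g+h)·(v_ḡ ⊗ (g+h))`. -/
theorem statement6 {F : Type*} [Field F] [IsAlgClosed F] {G : Type*} [AddCommGroup G]
    {R : Type*} [Ring R] [Algebra F R] (H : AddSubgroup G)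
    (n : ℕ) (hn : Nat.card ↥H = n) (hchar : ¬ (ringChar F ∣ n))
    {V : Type*} [AddCommGroup V] [Module F V] [Module R V] [IsScalarTower F R V]
    (𝒜 : AlgebraGrading F G R)
    (𝒱 : ModuleGrading 𝒜 (QuotientAddGroup.mk' H) V)
    (χs : Fin n → AddChar G Fˣ)
    (htrans : ∀ χ : AddChar G Fˣ, ∃! j : Fin n, ∀ h : ↥H, χ (h : G) = χs j (h : G))
    {I : Type*} [AddCommGroup I] [Module F I] [Module R I]
    (ι : AddChar G Fˣ → (V →ₗ[F] I))
    (hι1 : ∀ (χ ϖ : AddChar G Fˣ), (∀ h : ↥H, ϖ (h : G) = 1) →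
      ∀ (g : G), ∀ v ∈ 𝒱.comp ((QuotientAddGroup.mk' H) g),
        ι (χ * ϖ) v = ((ϖ g : Fˣ) : F) • ι χ v)
    (hι2 : ∀ (g' : G) (r : R), r ∈ 𝒜.comp g' → ∀ (χ : AddChar G Fˣ) (v : V),
      r • ι χ v = (((χ g')⁻¹ : Fˣ) : F) • ι χ (r • v))
    (hι3 : ∀ x : I, ∃ vv : Fin n → V, x = ∑ j, ι (χs j) (vv j))
    (hι4 : ∀ vv : Fin n → V, ∑ j, ι (χs j) (vv j) = 0 → ∀ j, vv j = 0)
    (iL : Module R ↥(LoopSubmodule (⇑(QuotientAddGroup.mk' H)) 𝒱.comp))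
    (hloop : IsLoopSMul 𝒜 (AddMonoidHom.id G) (⇑(QuotientAddGroup.mk' H)) 𝒱.comp iL) :
    -- (i): φ does not depend on the choice of transversal
    (∀ χs' : Fin n → AddChar G Fˣ,
      (∀ χ : AddChar G Fˣ, ∃! j : Fin n, ∀ h : ↥H, χ (h : G) = χs' j (h : G)) →
      ∀ (g : G), ∀ v ∈ 𝒱.comp ((QuotientAddGroup.mk' H) g),
        ∑ j, (((χs' j g)⁻¹ : Fˣ) : F) • ι (χs' j) v
          = ∑ j, (((χs j g)⁻¹ : Fˣ) : F) • ι (χs j) v) ∧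
    -- (ii)-(v): φ is a G-graded isomorphism of R-modules, with inverse ψ
    ∃ e : ↥(LoopSubmodule (⇑(QuotientAddGroup.mk' H)) 𝒱.comp) ≃ₗ[R] I,
      (∀ (g : G) (x : ↥(LoopSubmodule (⇑(QuotientAddGroup.mk' H)) 𝒱.comp)),
        x ∈ loopComp (⇑(QuotientAddGroup.mk' H)) 𝒱.comp g →
        e x = ∑ j, (((χs j g)⁻¹ : Fˣ) : F) • ι (χs j) ((↑x : G →₀ V) g)) ∧
      (∀ (g : G) (x : ↥(LoopSubmodule (⇑(QuotientAddGroup.mk' H)) 𝒱.comp)),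
        x ∈ loopComp (⇑(QuotientAddGroup.mk' H)) 𝒱.comp g →
        ∃ vv : Fin n → V,
          (∀ j, vv j ∈ 𝒱.comp ((QuotientAddGroup.mk' H) g)) ∧
          e x = ∑ j, ι (χs j) (vv j) ∧
          ∀ χ : AddChar G Fˣ,
            ∑ j, ι (χ * χs j) (vv j) = ((χ g : Fˣ) : F) • e x) ∧
      (∀ (j : Fin n) (g : G) (v : V), v ∈ 𝒱.comp ((QuotientAddGroup.mk' H) g) →
        (∀ a : G, a - g ∈ H →
          (↑(e.symm (ι (χs j) v)) : G →₀ V) a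
            = (n : F)⁻¹ • (((χs j a : Fˣ) : F) • v)) ∧
        (∀ a : G, a - g ∉ H → (↑(e.symm (ι (χs j) v)) : G →₀ V) a = 0)) := by
  classical
  have hn0 : n ≠ 0 := by rintro rfl; exact hchar (dvd_zero _)
  have hnF : (n : F) ≠ 0 := fun h => hchar ((ringChar.spec F n).mp h)
  haveI : Finite ↥H := Nat.finite_of_card_ne_zero (by rw [hn]; exact hn0)
  haveI : Fintype ↥H := Fintype.ofFinite _
  have hind := fun χs' htrans' g v hv =>
    indep H n 𝒱.comp ι hι1 χs htrans χs' htrans' g v hv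
  refine ⟨hind, ?_⟩
  let φ : ↥(LoopSubmodule (⇑(QuotientAddGroup.mk' H)) 𝒱.comp) → I :=
    fun x => bigPhi ι χs (x : G →₀ V)
  have hφadd : ∀ x y, φ (x + y) = φ x + φ y := fun x y =>
    map_add (bigPhi ι χs) (x : G →₀ V) (y : G →₀ V)
  have hφsmul : ∀ (r : R) x, φ (r • x) = r • φ x := by
    intro r x
    obtain ⟨t, c, hc, rfl⟩ := 𝒜.decomp.1 r
    rw [Finset.sum_smul, Finset.sum_smul]
    have : ∀ g ∈ t, φ (c g • x) = c g • φ x := fun g hg =>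
      bigPhi_smul ι χs g (c g) (hι2 g (c g) (hc g hg)) _ _
        (fun a => hloop (hc g hg) x a)
    rw [← Finset.sum_congr rfl this]
    exact map_sum (AddMonoidHom.mk' φ hφadd) _ _
  let φL : ↥(LoopSubmodule (⇑(QuotientAddGroup.mk' H)) 𝒱.comp) →ₗ[R] I :=
    { toFun := φ, map_add' := hφadd, map_smul' := hφsmul }
  have hinj : Function.Injective φL := by
    rw [injective_iff_map_eq_zero]
    intro x hx
    exact Subtype.ext (bigPhi_inj H n hn hnF 𝒱.comp 𝒱.decomp ι χs htrans hι4 x x.2 hx)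
  have hψ : ∀ (j : Fin n) (g : G) (v : V) (hv : v ∈ 𝒱.comp ((QuotientAddGroup.mk' H) g)),
      φL ⟨psiElt H n (χs j) g v, psiElt_mem H n 𝒱.comp (χs j) g v hv⟩ = ι (χs j) v :=
    fun j g v hv => bigPhi_psiElt H n hn hnF ι χs htrans j g v
  have hsurj : Function.Surjective φL := by
    intro y
    have hmem : y ∈ φL.toAddMonoidHom.range := by
      obtain ⟨vv, rfl⟩ := hι3 y
      refine AddSubgroup.sum_mem _ fun j _ => ?_
      obtain ⟨t, c, hc, h⟩ := 𝒱.decomp.1 (vv j)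
      rw [h, map_sum]
      refine AddSubgroup.sum_mem _ fun q hq => ?_
      obtain ⟨g, rfl⟩ := QuotientAddGroup.mk'_surjective H q
      exact ⟨_, hψ j g _ (hc _ hq)⟩
    exact hmem
  let e := LinearEquiv.ofBijective φL ⟨hinj, hsurj⟩
  have he : ∀ (g : G) (x : ↥(LoopSubmodule (⇑(QuotientAddGroup.mk' H)) 𝒱.comp)),
        x ∈ loopComp (⇑(QuotientAddGroup.mk' H)) 𝒱.comp g →
        e x = ∑ j, (((χs j g)⁻¹ : Fˣ) : F) • ι (χs j) ((↑x : G →₀ V) g) := by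
    intro g x hx
    have hs : (x : G →₀ V) = Finsupp.single g ((x : G →₀ V) g) := by
      ext a
      rw [Finsupp.single_apply]
      split_ifs with h
      · rw [h]
      · exact hx a (Ne.symm h)
    rw [← bigPhi_single, ← hs]
    rfl
  refine ⟨e, he, ?_, ?_⟩
  · intro g x hx
    refine ⟨fun j => (((χs j g)⁻¹ : Fˣ) : F) • (x : G →₀ V) g,
      fun j => Submodule.smul_mem _ _ (x.2 g), ?_, ?_⟩
    · rw [he g x hx]
      simp only [map_smul]
    · intro χ
      have htr : ∀ χ' : AddChar G Fˣ,
          ∃! j : Fin n, ∀ h : ↥H, χ' (h : G) = (χ * χs j) (h : G) := by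
        intro χ'
        have := htrans (χ⁻¹ * χ')
        simpa only [AddChar.mul_apply, AddChar.inv_apply', inv_mul_eq_iff_eq_mul] using this
      rw [he g x hx, ← hind (fun j => χ * χs j) htr g _ (x.2 g), Finset.smul_sum]
      refine Finset.sum_congr rfl fun j _ => ?_
      rw [map_smul, smul_smul, ← Units.val_mul, AddChar.mul_apply, mul_inv, mul_inv_cancel_left]
  · intro j g v hv
    have hes : e.symm (ι (χs j) v)
        = ⟨psiElt H n (χs j) g v, psiElt_mem H n 𝒱.comp (χs j) g v hv⟩ := by
      rw [LinearEquiv.symm_apply_eq]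
      exact (hψ j g v hv).symm
    rw [hes]
    exact ⟨fun a ha => psiElt_apply_mem H n (χs j) g v a ha,
      fun a ha => psiElt_apply_notMem H n (χs j) g v a ha⟩

end GradedPaper
end
end
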